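/- arXiv:0909.5315 — 5 statements merged into one kernel-verified Lean document; each statement's English description precedes it below -/
import Mathlib

section
/- There exists a constant η₀ > 0, depending only on μ₀ and V, such that: if I ⊂ ℝ is an interval of length |I| ≥ 1 and u : I → ℝ^k is a C¹ map satisfying ∫_I (|u'(x)|²/2 + V(u(x))) dx ≤ η₀, then dist(u(x), Σ) < μ₀ for all x ∈ I (equivalently, the front set D(u) ∩ I is empty). -/
open MeasureTheory Metric Set Filter
open scoped RealInnerProductSpace Pointwise Topology

noncomputable section

abbrev Euc (k : ℕ) : Type := EuclideanSpace ℝ (Fin k)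

/-- A smooth non-degenerate multiple-well potential with wells of equal depth (zero),
satisfying assumptions (H1), (H2), (H3) of the paper. `lamm σ` / `lamp σ` are the
smallest / largest eigenvalues of the Hessian `∇²V(σ)` at a well `σ`. -/
structure MultiWell (k : ℕ) where
  V : Euc k → ℝ
  wells : Finset (Euc k)
  lamm : Euc k → ℝ
  lamp : Euc k → ℝ
  smooth : ContDiff ℝ (⊤ : ℕ∞) V
  nonneg : ∀ y, 0 ≤ V y
  zero_iff : ∀ y, V y = 0 ↔ y ∈ wells
  two_le_card : 2 ≤ wells.card
  lamm_pos : ∀ σ ∈ wells, 0 < lamm σ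
  hess_lower : ∀ σ ∈ wells, ∀ w : Euc k,
    lamm σ * ‖w‖ ^ 2 ≤ iteratedFDeriv ℝ 2 V σ ![w, w]
  hess_upper : ∀ σ ∈ wells, ∀ w : Euc k,
    iteratedFDeriv ℝ 2 V σ ![w, w] ≤ lamp σ * ‖w‖ ^ 2
  coercive : ∃ α > (0:ℝ), ∃ R₀ > (0:ℝ), ∀ y : Euc k, R₀ < ‖y‖ →
    α * ‖y‖ ^ 2 ≤ ⟪y, gradient V y⟫

variable {k : ℕ}

/-- `μ₀` is small enough: the balls `B(σ, μ₀)` are pairwise disjoint and on each of them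
the Hessian of `V` is controlled from below by `λ⁻/2` and from above by `2λ⁺`. -/
def GoodRadius (P : MultiWell k) (μ₀ : ℝ) : Prop :=
  0 < μ₀ ∧
  (∀ σ ∈ P.wells, ∀ σ' ∈ P.wells, σ ≠ σ' → Disjoint (ball σ μ₀) (ball σ' μ₀)) ∧
  (∀ σ ∈ P.wells, ∀ y ∈ ball σ μ₀, ∀ w : Euc k,
    P.lamm σ / 2 * ‖w‖ ^ 2 ≤ iteratedFDeriv ℝ 2 P.V y ![w, w] ∧
    iteratedFDeriv ℝ 2 P.V y ![w, w] ≤ 2 * P.lamp σ * ‖w‖ ^ 2)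

/-- Rescaled energy density `e_ε(u) = ε|u'|²/2 + V(u)/ε`. -/
def eDen (P : MultiWell k) (ε : ℝ) (u : ℝ → Euc k) (x : ℝ) : ℝ :=
  ε * ‖deriv u x‖ ^ 2 / 2 + P.V (u x) / ε

/-- Total energy `E_ε(u) = ∫_ℝ e_ε(u)`. -/
def energy (P : MultiWell k) (ε : ℝ) (u : ℝ → Euc k) : ℝ := ∫ x, eDen P ε u x

/-- Discrepancy `ξ_ε(u) = ε|u'|²/2 − V(u)/ε`. -/
def discrep (P : MultiWell k) (ε : ℝ) (u : ℝ → Euc k) (x : ℝ) : ℝ :=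
  ε * ‖deriv u x‖ ^ 2 / 2 - P.V (u x) / ε

/-- The front set `D(u) = {x : dist(u(x), Σ) ≥ μ₀}`. -/
def frontSet (P : MultiWell k) (μ₀ : ℝ) (u : ℝ → Euc k) : Set ℝ :=
  {x : ℝ | μ₀ ≤ infDist (u x) (P.wells : Set (Euc k))}

/-- The clearing-out property for the constant `η₀` at scale `ε`: on any interval of length
`≥ ε` on which the energy is at most `η₀`, the map stays `μ₀`-close to the wells. -/
def ClearingOut (P : MultiWell k) (μ₀ η₀ ε : ℝ) : Prop :=
  ∀ u : ℝ → Euc k, ContDiff ℝ 1 u → ∀ a b : ℝ, ε ≤ b - a →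
    (∫ x in a..b, eDen P ε u x) ≤ η₀ →
    ∀ x ∈ Icc a b, infDist (u x) (P.wells : Set (Euc k)) < μ₀

/-- `v` is a (globally defined) smooth solution of `∂ₜ v − ∂ₓₓ v = −ε⁻² ∇V(v)`. -/
def IsSolution (P : MultiWell k) (ε : ℝ) (v : ℝ → ℝ → Euc k) : Prop :=
  ContDiff ℝ (⊤ : ℕ∞) (Function.uncurry v) ∧
  ∀ t x : ℝ, 0 < t →
    deriv (fun s => v s x) t - iteratedDeriv 2 (v t) x = -(ε ^ 2)⁻¹ • gradient P.V (v t x)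

/-- `(J, ρ)` is a `κ`-confined covering of `S` at scale `ρ`. -/
def IsConfCover {X : Type*} [MetricSpace X] (S : Set X) (J : Finset X) (κ ρ : ℝ) : Prop :=
  (S ⊆ ⋃ a ∈ J, ball a (κ * ρ)) ∧
  (∀ a ∈ J, (S ∩ ball a (κ * ρ)).Nonempty) ∧
  (∀ a ∈ J, ∀ b ∈ J, a ≠ b → κ⁻¹ * ρ ≤ dist a b)

/-- Outside a ball of radius `R₀` as in the coercivity assumption, `V` is nondecreasing along rays
from the origin. -/
theorem MultiWell.radial_mono (P : MultiWell k) {α R₀ R : ℝ} (hα : 0 < α) (hR₀ : 0 < R₀)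
    (hco : ∀ y : Euc k, R₀ < ‖y‖ → α * ‖y‖ ^ 2 ≤ ⟪y, gradient P.V y⟫) (hR : R₀ ≤ R)
    {y : Euc k} (hy : R ≤ ‖y‖) : P.V ((R / ‖y‖) • y) ≤ P.V y := by
  have hRpos : 0 < R := hR₀.trans_le hR
  have hypos : 0 < ‖y‖ := hRpos.trans_le hy
  have hle : R / ‖y‖ ≤ 1 := (div_le_one hypos).2 hy
  have hdV : Differentiable ℝ P.V := P.smooth.differentiable (by simp)
  have hderiv (t : ℝ) :
      HasDerivAt (fun t : ℝ => P.V (t • y)) ⟪gradient P.V (t • y), y⟫ t := by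
    have h := (hdV (t • y)).hasGradientAt.hasFDerivAt.comp_hasDerivAt t
      ((hasDerivAt_id t).smul_const y)
    simp only [one_smul, InnerProductSpace.toDual_apply_apply] at h
    exact h
  have hmono : MonotoneOn (fun t : ℝ => P.V (t • y)) (Icc (R / ‖y‖) 1) := by
    refine monotoneOn_of_deriv_nonneg (convex_Icc _ _)
      (fun t _ => (hderiv t).continuousAt.continuousWithinAt)
      (fun t _ => (hderiv t).differentiableAt.differentiableWithinAt) fun t ht => ?_
    rw [interior_Icc] at ht
    have htpos : 0 < t := (div_pos hRpos hypos).trans ht.1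
    have hnorm : R₀ < ‖t • y‖ := by
      rw [norm_smul, Real.norm_of_nonneg htpos.le]
      exact hR.trans_lt ((div_lt_iff₀ hypos).1 ht.1)
    have h := hco _ hnorm
    rw [real_inner_smul_left, real_inner_comm] at h
    rw [(hderiv t).deriv]
    have hnn : 0 ≤ α * ‖t • y‖ ^ 2 := by positivity
    exact nonneg_of_mul_nonneg_right (hnn.trans h) htpos
  simpa using hmono (left_mem_Icc.2 hle) (right_mem_Icc.2 hle) hle

/-- Away from its wells, the potential is bounded below by a positive constant. -/
theorem MultiWell.exists_pos_le (P : MultiWell k) {r : ℝ} (hr : 0 < r) :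
    ∃ c > (0 : ℝ), ∀ y, r ≤ infDist y (P.wells : Set (Euc k)) → c ≤ P.V y := by
  obtain ⟨α, hα, R₀, hR₀, hco⟩ := P.coercive
  obtain ⟨M, hM⟩ := P.wells.finite_toSet.isBounded.exists_norm_le
  have hne : (P.wells : Set (Euc k)).Nonempty :=
    Finset.card_pos.1 (zero_lt_two.trans_le P.two_le_card)
  set R := max R₀ (M + r)
  have hRpos : 0 < R := hR₀.trans_le (le_max_left _ _)
  have hK : IsCompact (closedBall (0 : Euc k) R ∩
      {y | r ≤ infDist y (P.wells : Set (Euc k))}) :=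
    (isCompact_closedBall _ _).inter_right
      (isClosed_le continuous_const (continuous_infDist_pt _))
  have hVpos : ∀ y ∈ closedBall (0 : Euc k) R ∩ {y | r ≤ infDist y (P.wells : Set (Euc k))},
      0 < P.V y := by
    rintro y ⟨-, hy⟩
    refine (P.nonneg y).lt_of_ne' fun h => ?_
    have h0 : infDist y (P.wells : Set (Euc k)) = 0 := infDist_zero_of_mem ((P.zero_iff y).1 h)
    exact absurd hy (by simpa [h0] using hr)
  obtain ⟨c, hc, hcK⟩ := hK.exists_forall_le' P.smooth.continuous.continuousOn hVpos
  refine ⟨c, hc, fun y hy => ?_⟩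
  rcases le_total ‖y‖ R with hyR | hyR
  · exact hcK y ⟨by simpa using hyR, hy⟩
  · have hypos : 0 < ‖y‖ := hRpos.trans_le hyR
    have hnorm : ‖(R / ‖y‖) • y‖ = R := by
      rw [norm_smul, Real.norm_of_nonneg (by positivity), div_mul_cancel₀ _ hypos.ne']
    refine le_trans (hcK _ ⟨mem_closedBall_zero_iff.2 hnorm.le, ?_⟩)
      (P.radial_mono hα hR₀ hco (le_max_left _ _) hyR)
    refine (le_infDist hne).2 fun σ hσ => ?_
    have h1 := norm_sub_norm_le ((R / ‖y‖) • y) σ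
    rw [dist_eq_norm]
    linarith [hM σ hσ, le_max_right R₀ (M + r)]

/-- A `C¹` curve moves by at most `(∫ ‖u'‖² / 2) / s + s / 2` over an interval of length at
most `1`. -/
theorem norm_sub_le_energy_div_add {E : Type*} [NormedAddCommGroup E] [NormedSpace ℝ E]
    [CompleteSpace E] {u : ℝ → E} (hu : ContDiff ℝ 1 u) {s x y : ℝ} (hs : 0 < s)
    (hxy : x ≤ y) (hlen : y - x ≤ 1) :
    ‖u y - u x‖ ≤ (∫ t in x..y, ‖deriv u t‖ ^ 2 / 2) / s + s / 2 := by
  have hc : Continuous (deriv u) := hu.continuous_deriv le_rfl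
  have hc2 : Continuous fun t => ‖deriv u t‖ ^ 2 / 2 := by fun_prop
  rw [← intervalIntegral.integral_deriv_eq_sub
    (fun t _ => (hu.differentiable one_ne_zero) t) (hc.intervalIntegrable _ _)]
  calc ‖∫ t in x..y, deriv u t‖ ≤ ∫ t in x..y, ‖deriv u t‖ :=
        intervalIntegral.norm_integral_le_integral_norm hxy
    _ ≤ ∫ t in x..y, (‖deriv u t‖ ^ 2 / 2 / s + s / 2) := by
        refine intervalIntegral.integral_mono_on hxy (hc.norm.intervalIntegrable _ _)
          ((hc2.div_const s |>.add continuous_const).intervalIntegrable _ _) fun t _ => ?_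
        rw [div_add_div _ _ hs.ne' two_ne_zero, le_div_iff₀ (by positivity)]
        nlinarith [sq_nonneg (‖deriv u t‖ - s)]
    _ = (∫ t in x..y, ‖deriv u t‖ ^ 2 / 2) / s + (y - x) * (s / 2) := by
        rw [intervalIntegral.integral_add ((hc2.div_const s).intervalIntegrable _ _)
          (continuous_const.intervalIntegrable _ _), intervalIntegral.integral_div,
          intervalIntegral.integral_const, smul_eq_mul]
    _ ≤ _ := by nlinarith

/-- Clearing-out lemma: there is `η₀ > 0`, depending only on `μ₀` and `V`,
such that if `u` is `C¹` and its energy on an interval `[a,b]` of length `≥ 1` is at most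
`η₀`, then `dist(u x, Σ) < μ₀` for all `x ∈ [a,b]`. -/
theorem clearing_out (P : MultiWell k) (μ₀ : ℝ) (hμ : GoodRadius P μ₀) :
    ∃ η₀ > (0:ℝ), ∀ u : ℝ → Euc k, ContDiff ℝ 1 u → ∀ a b : ℝ, 1 ≤ b - a →
      (∫ x in a..b, (‖deriv u x‖ ^ 2 / 2 + P.V (u x))) ≤ η₀ →
      ∀ x ∈ Icc a b, infDist (u x) (P.wells : Set (Euc k)) < μ₀ := by
  obtain ⟨hμpos, -, -⟩ := hμ
  obtain ⟨c, hc, hcV⟩ := P.exists_pos_le (half_pos hμpos)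
  refine ⟨min (c / 2) (μ₀ ^ 2 / 8), by positivity, fun u hu a b hab hE x hx => ?_⟩
  by_contra! hfar
  have hcu : Continuous (deriv u) := hu.continuous_deriv le_rfl
  have hcV' : Continuous fun t => P.V (u t) := P.smooth.continuous.comp hu.continuous
  have hckin : Continuous fun t => ‖deriv u t‖ ^ 2 / 2 := by fun_prop
  have hcden : Continuous fun t => ‖deriv u t‖ ^ 2 / 2 + P.V (u t) := hckin.add hcV'
  have hden (t : ℝ) : 0 ≤ ‖deriv u t‖ ^ 2 / 2 + P.V (u t) :=
    add_nonneg (by positivity) (P.nonneg _)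
  have hsub {y z : ℝ} (hay : a ≤ y) (hyz : y ≤ z) (hzb : z ≤ b) :
      ∫ t in y..z, (‖deriv u t‖ ^ 2 / 2 + P.V (u t)) ≤ min (c / 2) (μ₀ ^ 2 / 8) :=
    (intervalIntegral.integral_mono_interval hay hyz hzb (ae_of_all _ hden)
      (hcden.intervalIntegrable _ _)).trans hE
  have hmove {y z : ℝ} (hay : a ≤ y) (hyz : y ≤ z) (hzb : z ≤ b) (hlen : z - y ≤ 1) :
      ‖u z - u y‖ ≤ μ₀ / 2 := by
    refine (norm_sub_le_energy_div_add hu (half_pos hμpos) hyz hlen).trans ?_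
    have hkin : ∫ t in y..z, ‖deriv u t‖ ^ 2 / 2 ≤ μ₀ ^ 2 / 8 :=
      (intervalIntegral.integral_mono_on hyz (hckin.intervalIntegrable _ _)
        (hcden.intervalIntegrable _ _) fun t _ => le_add_of_nonneg_right (P.nonneg _)).trans
        ((hsub hay hyz hzb).trans (min_le_right _ _))
    have hdiv : (∫ t in y..z, ‖deriv u t‖ ^ 2 / 2) / (μ₀ / 2) ≤ μ₀ / 4 := by
      rw [div_le_iff₀ (half_pos hμpos)]
      linarith
    linarith
  set p := max a (x - 1)
  have hap : a ≤ p := le_max_left _ _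
  have hxp : x ≤ p + 1 := by linarith [le_max_right a (x - 1)]
  have hpx : p ≤ x := max_le hx.1 (by linarith)
  have hpb : p + 1 ≤ b := by
    have : p ≤ b - 1 := max_le (by linarith) (by linarith [hx.2])
    linarith
  have hV : ∀ t ∈ Icc p (p + 1), c ≤ ‖deriv u t‖ ^ 2 / 2 + P.V (u t) := by
    rintro t ⟨hpt, htp⟩
    have hdist : dist (u x) (u t) ≤ μ₀ / 2 := by
      rcases le_total t x with htx | htx
      · rw [dist_eq_norm]
        exact hmove (hap.trans hpt) htx hx.2 (by linarith)
      · rw [dist_comm, dist_eq_norm]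
        exact hmove hx.1 htx (htp.trans hpb) (by linarith)
    refine (hcV _ ?_).trans (le_add_of_nonneg_left (by positivity))
    linarith [infDist_le_infDist_add_dist (s := (P.wells : Set (Euc k))) (x := u x) (y := u t)]
  have hlow := intervalIntegral.integral_mono_on (μ := volume) (by linarith : p ≤ p + 1)
    intervalIntegrable_const (hcden.intervalIntegrable _ _) hV
  rw [intervalIntegral.integral_const, add_sub_cancel_left, one_smul] at hlow
  linarith [hsub hap (by linarith) hpb, min_le_left (c / 2) (μ₀ ^ 2 / 8)]
end
end

section
/- Let η₀ > 0 be the clearing-out constant (depending only on μ₀ and V). If u : ℝ → ℝ^k is a C¹ map with energy E(u) = ∫_ℝ (|u'|²/2 + V(u)) dx ≤ M₀ < ∞, then there exist an integer ℓ ≤ M₀/η₀ and points x_1, …, x_ℓ in the front set D(u) such that D(u) ⊂ ∪_{i=1}^ℓ [x_i − 1, x_i + 1]. -/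
open MeasureTheory Metric Set Filter
open scoped RealInnerProductSpace Pointwise Topology

noncomputable section

variable {k : ℕ}

/-- A set whose `δ`-separated finite subsets have at most `C` points is covered by at most `C`
closed balls of radius `δ` centered in the set. -/
theorem exists_finset_closedBall_cover_of_card_le {X : Type*} [PseudoMetricSpace X] (A : Set X)
    {δ : ℝ} (hδ : 0 ≤ δ) (C : ℝ)
    (hC : ∀ S : Finset X, (S : Set X) ⊆ A →
      (S : Set X).Pairwise (fun x y => δ < dist x y) → (S.card : ℝ) ≤ C) :
    ∃ S : Finset X, (S.card : ℝ) ≤ C ∧ (S : Set X) ⊆ A ∧ A ⊆ ⋃ x ∈ S, closedBall x δ := by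
  classical
  by_contra! hcon
  have large : ∀ n : ℕ, ∃ S : Finset X, n ≤ S.card ∧ (S : Set X) ⊆ A ∧
      (S : Set X).Pairwise (fun x y => δ < dist x y) := by
    intro n
    induction n with
    | zero => exact ⟨∅, by simp⟩
    | succ n ih =>
      obtain ⟨S, hcard, hSA, hsep⟩ := ih
      obtain ⟨y, hyA, hy⟩ := Set.not_subset.1 (hcon S (hC S hSA hsep) hSA)
      simp only [mem_iUnion, mem_closedBall, not_exists, not_le] at hy
      have hyS : y ∉ S := fun h => (hy y h).not_ge (by simpa using hδ)
      refine ⟨insert y S, by rw [Finset.card_insert_of_notMem hyS]; omega, ?_, ?_⟩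
      · rw [Finset.coe_insert]
        exact Set.insert_subset hyA hSA
      · rw [Finset.coe_insert]
        refine hsep.insert fun x hx _ => ⟨hy x hx, ?_⟩
        rw [dist_comm]
        exact hy x hx
  obtain ⟨n, hn⟩ := exists_nat_gt C
  obtain ⟨S, hcard, hSA, hsep⟩ := large n
  have := hC S hSA hsep
  have : (n : ℝ) ≤ S.card := by exact_mod_cast hcard
  linarith

theorem eDen_nonneg (P : MultiWell k) {ε : ℝ} (hε : 0 ≤ ε) (u : ℝ → Euc k) (x : ℝ) :
    0 ≤ eDen P ε u x := by
  have := P.nonneg (u x)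
  unfold eDen
  positivity

/-- Around a point of the front set the energy exceeds the clearing-out constant. -/
theorem ClearingOut.lt_setIntegral_eDen {P : MultiWell k} {μ₀ η₀ : ℝ}
    (hco : ClearingOut P μ₀ η₀ 1) {u : ℝ → Euc k} (hu : ContDiff ℝ 1 u) {x : ℝ}
    (hx : x ∈ frontSet P μ₀ u) :
    η₀ < ∫ t in Ioc (x - 1 / 2) (x + 1 / 2), eDen P 1 u t := by
  rw [← intervalIntegral.integral_of_le (by linarith)]
  by_contra! hle
  have hlt := hco u hu _ _ (by linarith) hle x ⟨by linarith, by linarith⟩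
  exact hlt.not_ge hx

theorem card_mul_le_energy_of_separated {P : MultiWell k} {μ₀ η₀ : ℝ}
    (hco : ClearingOut P μ₀ η₀ 1) {u : ℝ → Euc k} (hu : ContDiff ℝ 1 u)
    (hInt : Integrable (eDen P 1 u)) {S : Finset ℝ} (hS : (S : Set ℝ) ⊆ frontSet P μ₀ u)
    (hsep : (S : Set ℝ).Pairwise (fun x y => 1 < dist x y)) :
    S.card * η₀ ≤ energy P 1 u := by
  have hdisj : (S : Set ℝ).Pairwise
      (Function.onFun Disjoint fun x => Ioc (x - 1 / 2) (x + 1 / 2)) := by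
    intro x hx y hy hxy
    refine Set.disjoint_left.2 fun t htx hty => (hsep hx hy hxy).not_ge ?_
    rw [Real.dist_eq, abs_le]
    constructor <;> linarith [htx.1, htx.2, hty.1, hty.2]
  calc S.card * η₀ = ∑ x ∈ S, η₀ := by simp
    _ ≤ ∑ x ∈ S, ∫ t in Ioc (x - 1 / 2) (x + 1 / 2), eDen P 1 u t :=
      Finset.sum_le_sum fun x hx => (hco.lt_setIntegral_eDen hu (hS hx)).le
    _ = ∫ t in ⋃ x ∈ S, Ioc (x - 1 / 2) (x + 1 / 2), eDen P 1 u t :=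
      (integral_biUnion_finset S (fun _ _ => measurableSet_Ioc) hdisj
        fun _ _ => hInt.integrableOn).symm
    _ ≤ energy P 1 u :=
      setIntegral_le_integral hInt (ae_of_all _ (eDen_nonneg P zero_le_one u))

/-- if `E(u) ≤ M₀ < ∞`, the front set `D(u)` is covered by at most `M₀/η₀`
intervals `[xᵢ - 1, xᵢ + 1]` centered at points of `D(u)`. -/
theorem front_set_covering (P : MultiWell k) (μ₀ η₀ M₀ : ℝ)
    (hμ : GoodRadius P μ₀) (hη : 0 < η₀) (hco : ClearingOut P μ₀ η₀ 1)
    (u : ℝ → Euc k) (hu : ContDiff ℝ 1 u)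
    (hInt : Integrable (eDen P 1 u)) (hE : energy P 1 u ≤ M₀) :
    ∃ (ℓ : ℕ) (x : Fin ℓ → ℝ), (ℓ : ℝ) ≤ M₀ / η₀ ∧
      (∀ i, x i ∈ frontSet P μ₀ u) ∧
      frontSet P μ₀ u ⊆ ⋃ i, Icc (x i - 1) (x i + 1) := by
  obtain ⟨S, hcard, hS, hcover⟩ := exists_finset_closedBall_cover_of_card_le
    (frontSet P μ₀ u) zero_le_one (M₀ / η₀) fun S hS hsep =>
      (le_div_iff₀ hη).2 ((card_mul_le_energy_of_separated hco hu hInt hS hsep).trans hE)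
  refine ⟨S.card, fun i => S.equivFin.symm i, hcard, fun i => hS (S.equivFin.symm i).2, ?_⟩
  intro y hy
  obtain ⟨x, hx, hyx⟩ := mem_iUnion₂.1 (hcover hy)
  rw [Real.closedBall_eq_Icc] at hyx
  exact mem_iUnion.2 ⟨S.equivFin ⟨x, hx⟩, by simpa using hyx⟩
end
end

section
/- Let X be a metric space and let a_1, …, a_ℓ be ℓ distinct points of X. Let δ > 0 and 0 < κ < 1 be given. Then there exist ρ with δ ≤ ρ ≤ κ^{−2(ℓ−1)} δ and a subset J of {a_1, …, a_ℓ} such that (J, ρ) is a κ-confined covering of the set S = {a_1, …, a_ℓ} at scale ρ. -/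
open MeasureTheory Metric Set Filter
open scoped RealInnerProductSpace Pointwise Topology

noncomputable section

variable {k : ℕ}

/-- Along an increasing sequence of positive scales `r`, the maximal size of an `r j`-separated
subset of a finite set `s` cannot drop `s.card` times; hence some subset of `s` is
`r (j + 1)`-separated and covers `s` at scale `r j`. -/
theorem exists_separated_subset_covering {X : Type*} [MetricSpace X] {s : Finset X}
    (hs : s.Nonempty) {r : ℕ → ℝ} (hr : Monotone r) (hr0 : ∀ j, 0 < r j) :
    ∃ j < s.card, ∃ J ⊆ s, (J : Set X).Pairwise (fun x y => r (j + 1) ≤ dist x y) ∧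
      ∀ x ∈ s, ∃ y ∈ J, dist x y < r j := by
  classical
  by_contra! hcon
  have card_le : ∀ j ≤ s.card, ∀ J ⊆ s,
      (J : Set X).Pairwise (fun x y => r j ≤ dist x y) → J.card + j ≤ s.card := by
    intro j
    induction j with
    | zero => exact fun _ J hJ _ => Finset.card_le_card hJ
    | succ j ih =>
      intro hj J hJ hsep
      obtain ⟨x, hx, hfar⟩ := hcon j hj J hJ hsep
      have hxJ : x ∉ J := fun h => (hr0 j).not_ge (by simpa using hfar x h)
      have hins : ((insert x J : Finset X) : Set X).Pairwise (fun x y => r j ≤ dist x y) := by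
        rw [Finset.coe_insert]
        refine (hsep.imp fun _ _ h => (hr j.le_succ).trans h).insert fun y hy _ =>
          ⟨hfar y hy, ?_⟩
        rw [dist_comm]
        exact hfar y hy
      have := ih (by omega) _ (Finset.insert_subset hx hJ) hins
      rw [Finset.card_insert_of_notMem hxJ] at this
      omega
  obtain ⟨x, hx⟩ := hs
  have := card_le s.card le_rfl {x} (by simpa using hx) (by simp)
  simp at this

/-- κ-confinement lemma: given `ℓ` distinct points of a metric space `X`,
`δ > 0` and `0 < κ < 1`, there exist a scale `ρ ∈ [δ, κ^{-2(ℓ-1)}δ]` and a subset `J` of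
the given points such that `(J, ρ)` is a `κ`-confined covering of the set of points. -/
theorem kappa_confinement {X : Type*} [MetricSpace X]
    (ℓ : ℕ) (hℓ : 1 ≤ ℓ) (a : Fin ℓ → X) (ha : Function.Injective a)
    (δ κ : ℝ) (hδ : 0 < δ) (hκ0 : 0 < κ) (hκ1 : κ < 1) :
    ∃ ρ : ℝ, δ ≤ ρ ∧ ρ ≤ κ ^ (-(2 * ((ℓ : ℤ) - 1))) * δ ∧
      ∃ J : Finset X, ↑J ⊆ Set.range a ∧ IsConfCover (Set.range a) J κ ρ := by
  classical
  have hinv : 1 ≤ κ⁻¹ := (one_le_inv₀ hκ0).2 hκ1.le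
  have hcard : (Finset.univ.image a).card = ℓ := by
    simp [Finset.card_image_of_injective _ ha]
  have hne : (Finset.univ.image a).Nonempty := Finset.card_pos.1 (by omega)
  obtain ⟨j, hj, J, hJ, hsep, hcov⟩ := exists_separated_subset_covering hne
    (r := fun j => κ * (κ⁻¹ ^ (2 * j) * δ))
    (fun i j hij => by dsimp only; gcongr) (fun j => by positivity)
  rw [hcard] at hj
  have hJ' : (J : Set X) ⊆ Set.range a := by
    simpa using Finset.coe_subset.2 hJ
  refine ⟨κ⁻¹ ^ (2 * j) * δ, le_mul_of_one_le_left hδ.le (one_le_pow₀ hinv), ?_, J, hJ', ?_, ?_, ?_⟩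
  · have hexp : (2 * ((ℓ : ℤ) - 1)) = ((2 * (ℓ - 1) : ℕ) : ℤ) := by
      push_cast [Nat.cast_sub hℓ]
      ring
    rw [hexp, ← inv_zpow', zpow_natCast]
    gcongr
    omega
  · rintro _ ⟨i, rfl⟩
    obtain ⟨y, hy, hlt⟩ := hcov (a i) (by simp)
    exact Set.mem_biUnion hy hlt
  · exact fun x hx => ⟨x, hJ' hx, mem_ball_self (by positivity)⟩
  · intro x hx y hy hxy
    refine le_of_eq_of_le ?_ (hsep hx hy hxy)
    rw [mul_add_one, pow_add]
    field_simp
end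
end

section
/- Let ε > 0 and let u : ℝ → ℝ^k be a C¹ map with E_ε(u) ≤ M₀ < ∞, where M₀ ≥ η₀. Given δ > 0 and 0 < κ < 1 satisfying κδ > 2ε, there exist ρ with δ ≤ ρ ≤ (κ/2)^{−2M₀/η₀} δ and a finite subset J ⊂ D(u) with #J ≤ M₀/η₀ such that (J, ρ) is a κ-confined covering of D(u) at scale ρ. -/
open MeasureTheory Metric Set Filter
open scoped RealInnerProductSpace Pointwise Topology

noncomputable section

variable {k : ℕ}

/-- A finite covering by balls of radius `κ * ρ` can be thinned to a `κ`-confined covering, at the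
cost of enlarging the scale by a factor `(κ / 2)⁻²` for each discarded centre. -/
theorem exists_subset_isConfCover {X : Type*} [MetricSpace X] {S : Set X} {κ : ℝ}
    (hκ0 : 0 < κ) (hκ1 : κ < 1) (n : ℕ) (J : Finset X) (hn : J.card = n) (hJ : ↑J ⊆ S)
    (ρ : ℝ) (hρ : 0 < ρ) (hcov : S ⊆ ⋃ a ∈ J, ball a (κ * ρ)) :
    ∃ ρ' : ℝ, ρ ≤ ρ' ∧ ρ' ≤ ((κ / 2) ^ 2)⁻¹ ^ n * ρ ∧ ∃ J' ⊆ J, IsConfCover S J' κ ρ' := by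
  classical
  have hq : 1 + κ⁻¹ ^ 2 ≤ ((κ / 2) ^ 2)⁻¹ := by
    have h1 : 1 ≤ κ⁻¹ := (one_le_inv₀ hκ0).2 hκ1.le
    have h2 : ((κ / 2) ^ 2)⁻¹ = 4 * κ⁻¹ ^ 2 := by field_simp; norm_num
    nlinarith
  have hq1 : 1 ≤ ((κ / 2) ^ 2)⁻¹ := le_trans (by nlinarith [sq_nonneg κ⁻¹]) hq
  induction n generalizing J ρ with
  | zero =>
    refine ⟨ρ, le_rfl, by simp, J, Finset.Subset.refl _, hcov, ?_, ?_⟩ <;>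
      simp [Finset.card_eq_zero.1 hn]
  | succ n ih =>
    by_cases hsep : ∀ a ∈ J, ∀ b ∈ J, a ≠ b → κ⁻¹ * ρ ≤ dist a b
    · exact ⟨ρ, le_rfl, le_mul_of_one_le_left hρ.le (one_le_pow₀ hq1), J, Finset.Subset.refl _,
        hcov, fun a ha => ⟨a, hJ ha, mem_ball_self (by positivity)⟩, hsep⟩
    push Not at hsep
    obtain ⟨a, ha, b, hb, hab, hlt⟩ := hsep
    set ρ₁ := (1 + κ⁻¹ ^ 2) * ρ with hρ₁
    have hρle : ρ ≤ ρ₁ := le_mul_of_one_le_left hρ.le (by nlinarith [sq_nonneg κ⁻¹])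
    have hrad : κ * ρ₁ = κ * ρ + κ⁻¹ * ρ := by rw [hρ₁]; field_simp
    obtain ⟨ρ', h1, h2, J', hJ', hc⟩ := ih (J.erase b) (by simp [Finset.card_erase_of_mem hb, hn])
      (fun x hx => hJ (Finset.mem_of_mem_erase hx)) ρ₁ (hρ.trans_le hρle) (by
        intro x hx
        obtain ⟨c, hc, hxc⟩ := mem_iUnion₂.1 (hcov hx)
        rw [mem_ball] at hxc
        by_cases hcb : c = b
        · subst hcb
          refine mem_iUnion₂.2 ⟨a, Finset.mem_erase.2 ⟨hab, ha⟩, ?_⟩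
          rw [mem_ball, hrad]
          linarith [dist_triangle x c a, dist_comm a c]
        · exact mem_iUnion₂.2 ⟨c, Finset.mem_erase.2 ⟨hcb, hc⟩,
            hxc.trans_le (mul_le_mul_of_nonneg_left hρle hκ0.le)⟩)
    refine ⟨ρ', hρle.trans h1, h2.trans ?_, J', hJ'.trans (Finset.erase_subset _ _), hc⟩
    rw [pow_succ _ n, mul_assoc, hρ₁]
    gcongr

/-- If the finite `r`-separated subsets of `S` have bounded cardinality, one of them is an
`r`-net of `S`. -/
theorem exists_separated_net {X : Type*} [MetricSpace X] {S : Set X} {r : ℝ} {N : ℕ} (hr : 0 < r)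
    (hN : ∀ J : Finset X, ↑J ⊆ S → (∀ a ∈ J, ∀ b ∈ J, a ≠ b → r ≤ dist a b) → J.card ≤ N) :
    ∃ J : Finset X, ↑J ⊆ S ∧ (∀ a ∈ J, ∀ b ∈ J, a ≠ b → r ≤ dist a b) ∧
      S ⊆ ⋃ a ∈ J, ball a r := by
  classical
  let p : ℕ → Prop := fun n => ∃ J : Finset X, J.card = n ∧ ↑J ⊆ S ∧
    ∀ a ∈ J, ∀ b ∈ J, a ≠ b → r ≤ dist a b
  have hp0 : p 0 := ⟨∅, by simp⟩
  obtain ⟨J, hcard, hJS, hsep⟩ := Nat.findGreatest_spec (P := p) (Nat.zero_le N) hp0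
  refine ⟨J, hJS, hsep, fun x hx => ?_⟩
  by_contra hxJ
  simp only [mem_iUnion, mem_ball, not_exists, not_lt] at hxJ
  have hxmem : x ∉ J := fun h => by simpa using (hxJ x h).trans_lt' hr
  have hins : ↑(insert x J) ⊆ S := by
    rw [Finset.coe_insert]
    exact insert_subset hx hJS
  have hinssep : ∀ a ∈ insert x J, ∀ b ∈ insert x J, a ≠ b → r ≤ dist a b := by
    intro a ha b hb hab
    rcases Finset.mem_insert.1 ha with rfl | haJ <;>
      rcases Finset.mem_insert.1 hb with rfl | hbJ
    · exact absurd rfl hab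
    · exact hxJ b hbJ
    · rw [dist_comm]; exact hxJ a haJ
    · exact hsep a haJ b hbJ hab
  have hmax : (insert x J).card ≤ Nat.findGreatest p N :=
    Nat.le_findGreatest (hN _ hins hinssep) ⟨_, rfl, hins, hinssep⟩
  rw [Finset.card_insert_of_notMem hxmem] at hmax
  omega

/-- An `ε`-separated set of front points has at most `M₀ / η₀` elements, as each of them carries
energy at least `η₀` in the interval of length `ε` around it. -/
theorem card_mul_le_of_separated {P : MultiWell k} {μ₀ η₀ M₀ ε : ℝ} (hε : 0 < ε)
    (hco : ClearingOut P μ₀ η₀ ε) {u : ℝ → Euc k} (hu : ContDiff ℝ 1 u)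
    (hInt : Integrable (eDen P ε u)) (hE : energy P ε u ≤ M₀) {J : Finset ℝ}
    (hJ : ↑J ⊆ frontSet P μ₀ u) (hsep : ∀ a ∈ J, ∀ b ∈ J, a ≠ b → ε ≤ dist a b) :
    J.card * η₀ ≤ M₀ := by
  have hnonneg : ∀ x, 0 ≤ eDen P ε u x := fun x =>
    add_nonneg (by positivity) (div_nonneg (P.nonneg _) hε.le)
  let I : ℝ → Set ℝ := fun x => Ioc (x - ε / 2) (x + ε / 2)
  have hI : ∀ x ∈ J, η₀ ≤ ∫ y in I x, eDen P ε u y := by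
    intro x hx
    by_contra! hlt
    rw [← intervalIntegral.integral_of_le (by linarith)] at hlt
    exact (hJ hx).not_gt
      (hco u hu _ _ (by linarith) hlt.le x ⟨by linarith, by linarith⟩)
  have hdisj : (J : Set ℝ).Pairwise (Function.onFun Disjoint I) := by
    intro a ha b hb hab
    refine Set.disjoint_left.2 fun y hya hyb => (hsep a ha b hb hab).not_gt ?_
    rw [Real.dist_eq, abs_lt]
    constructor <;> linarith [hya.1, hya.2, hyb.1, hyb.2]
  calc (J.card : ℝ) * η₀ = ∑ _x ∈ J, η₀ := by simp
    _ ≤ ∑ x ∈ J, ∫ y in I x, eDen P ε u y := Finset.sum_le_sum hI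
    _ = ∫ y in ⋃ x ∈ J, I x, eDen P ε u y :=
      (integral_biUnion_finset J (fun _ _ => measurableSet_Ioc) hdisj
        fun _ _ => hInt.integrableOn).symm
    _ ≤ ∫ y, eDen P ε u y :=
      setIntegral_le_integral hInt (Eventually.of_forall hnonneg)
    _ ≤ M₀ := hE

/-- for a map `u` of energy at most `M₀`, and `δ, κ` with `κδ > 2ε`, there are
a scale `ρ ∈ [δ, (κ/2)^{-2M₀/η₀}δ]` and a finite `J ⊆ D(u)` with `#J ≤ M₀/η₀` such that
`(J, ρ)` is a `κ`-confined covering of the front set `D(u)`. -/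
theorem confined_covering_of_front_set (P : MultiWell k) (μ₀ η₀ M₀ ε : ℝ)
    (hμ : GoodRadius P μ₀) (hη : 0 < η₀) (hM : η₀ ≤ M₀) (hε : 0 < ε)
    (hco : ClearingOut P μ₀ η₀ ε)
    (u : ℝ → Euc k) (hu : ContDiff ℝ 1 u)
    (hInt : Integrable (eDen P ε u)) (hE : energy P ε u ≤ M₀)
    (δ κ : ℝ) (hδ : 0 < δ) (hκ0 : 0 < κ) (hκ1 : κ < 1) (hκδ : 2 * ε < κ * δ) :
    ∃ ρ : ℝ, δ ≤ ρ ∧ ρ ≤ (κ / 2) ^ (-(2 * M₀ / η₀)) * δ ∧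
      ∃ J : Finset ℝ, ↑J ⊆ frontSet P μ₀ u ∧ (J.card : ℝ) ≤ M₀ / η₀ ∧
        IsConfCover (frontSet P μ₀ u) J κ ρ := by
  have hcard : ∀ J : Finset ℝ, ↑J ⊆ frontSet P μ₀ u →
      (∀ a ∈ J, ∀ b ∈ J, a ≠ b → κ * δ ≤ dist a b) → (J.card : ℝ) ≤ M₀ / η₀ := by
    intro J hJ hsep
    rw [le_div_iff₀ hη]
    exact card_mul_le_of_separated hε hco hu hInt hE hJ fun a ha b hb hab =>
      le_trans (by linarith) (hsep a ha b hb hab)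
  obtain ⟨J, hJ, hsep, hcov⟩ := exists_separated_net (mul_pos hκ0 hδ) fun J hJ hsep =>
    Nat.le_floor (hcard J hJ hsep)
  obtain ⟨ρ, h1, h2, J', hJ', hconf⟩ :=
    exists_subset_isConfCover hκ0 hκ1 J.card J rfl hJ δ hδ hcov
  have hJc := hcard J hJ hsep
  refine ⟨ρ, h1, h2.trans (mul_le_mul_of_nonneg_right ?_ hδ.le), J',
    (Finset.coe_subset.2 hJ').trans hJ,
    le_trans (by exact_mod_cast Finset.card_le_card hJ') hJc, hconf⟩
  have hpow : ((κ / 2) ^ 2)⁻¹ ^ J.card = (κ / 2) ^ (-(2 * (J.card : ℝ))) := by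
    rw [Real.rpow_neg (by positivity), inv_pow, ← pow_mul, ← Real.rpow_natCast]
    push_cast
    rfl
  rw [hpow]
  refine Real.rpow_le_rpow_of_exponent_ge (by positivity) (by linarith) ?_
  rw [mul_div_assoc]
  linarith
end
end

section
/- There exists a constant K₁ > 0 depending only on V such that: if x₀ ∈ ℝ and R ≥ α₀ε satisfy [x₀ − 2R, x₀ + 2R] ∩ D(0) = ∅, then ε³|∂_t v_ε(x,t)|² + e_ε(v_ε(x,t)) ≤ K₁ M₀ ε⁻¹ [ exp(−t/(K₁ε²)) + (t/R²) exp(−R/(K₁ε)) ] pointwise for all (x,t) ∈ [x₀ − R/2, x₀ + R/2] × [ε², (R/K₀)² exp(R/(K₀ε))], where K₀ is the constant (depending only on V and M₀) from the slow-motion theorem. -/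
open MeasureTheory Metric Set Filter
open scoped RealInnerProductSpace Pointwise Topology

noncomputable section

variable {k : ℕ}

section MaximumPrinciple

/-- The derivative at `t` is nonnegative when `t` maximizes `f` on a left neighbourhood. -/
theorem HasDerivAt.nonneg_of_eventually_le_left {f : ℝ → ℝ} {a t : ℝ} (hf : HasDerivAt f a t)
    (hmax : ∀ᶠ s in 𝓝[<] t, f s ≤ f t) : 0 ≤ a := by
  have hs := (hasDerivAt_iff_tendsto_slope.1 hf).mono_left
    (nhdsWithin_mono t (s := Iio t) fun s hs => ne_of_lt hs)
  refine ge_of_tendsto hs ?_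
  filter_upwards [hmax, self_mem_nhdsWithin] with s hs hst
  rw [slope_def_field]
  have hst' : s < t := hst
  exact div_nonneg_of_nonpos (by linarith) (by linarith)

/-- The second derivative is nonpositive at a local maximum. -/
theorem IsLocalMax.second_deriv_nonpos {f f' : ℝ → ℝ} {b x : ℝ} (hmax : IsLocalMax f x)
    (hf : ∀ y, HasDerivAt f (f' y) y) (hf' : HasDerivAt f' b x) : b ≤ 0 := by
  by_contra! hb
  have hd : deriv f = f' := funext fun y => (hf y).deriv
  have hmin : IsLocalMin f x := by
    refine isLocalMin_of_deriv_deriv_pos ?_ ?_ (hf x).continuousAt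
    · rw [hd, hf'.deriv]; exact hb
    · exact hmax.deriv_eq_zero
  have hconst : f =ᶠ[𝓝 x] fun _ => f x := by
    filter_upwards [hmax, hmin] with y h₁ h₂ using le_antisymm h₁ h₂
  have h0 : f' =ᶠ[𝓝 x] fun _ => 0 := by
    have := hconst.deriv
    rw [hd] at this
    simpa using this
  have := hf'.deriv
  rw [h0.deriv_eq] at this
  simp at this
  linarith

/-- Weak parabolic maximum principle on a rectangle. -/
theorem nonpos_of_parabolic {H : ℝ → ℝ → ℝ} {ρ T : ℝ}
    (hc : ContinuousOn (Function.uncurry H) (Icc 0 T ×ˢ Icc (-ρ) ρ))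
    (h0 : ∀ x ∈ Icc (-ρ) ρ, H 0 x ≤ 0)
    (hl : ∀ t ∈ Icc 0 T, H t (-ρ) ≤ 0) (hr : ∀ t ∈ Icc 0 T, H t ρ ≤ 0)
    (hint : ∀ t ∈ Ioc 0 T, ∀ x ∈ Ioo (-ρ) ρ, 0 < H t x →
      ∃ (a b : ℝ) (H' : ℝ → ℝ), HasDerivAt (fun s => H s x) a t ∧
        (∀ y, HasDerivAt (H t) (H' y) y) ∧ HasDerivAt H' b x ∧ a < b) :
    ∀ t ∈ Icc 0 T, ∀ x ∈ Icc (-ρ) ρ, H t x ≤ 0 := by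
  intro t₁ ht₁ x₁ hx₁
  obtain ⟨⟨t, x⟩, ⟨ht, hx⟩, hmax⟩ := (isCompact_Icc.prod isCompact_Icc).exists_isMaxOn
    ⟨(t₁, x₁), ht₁, hx₁⟩ hc
  have hle : ∀ s ∈ Icc 0 T, ∀ y ∈ Icc (-ρ) ρ, H s y ≤ H t x := fun s hs y hy =>
    hmax (show (s, y) ∈ Icc 0 T ×ˢ Icc (-ρ) ρ from ⟨hs, hy⟩)
  simp only at ht hx
  refine (hle t₁ ht₁ x₁ hx₁).trans ?_
  by_contra! hpos
  have ht0 : 0 < t := ht.1.lt_of_ne (by rintro rfl; exact (h0 x hx).not_gt hpos)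
  have hxl : -ρ < x := hx.1.lt_of_ne (by rintro rfl; exact (hl t ht).not_gt hpos)
  have hxr : x < ρ := hx.2.lt_of_ne (by rintro rfl; exact (hr t ht).not_gt hpos)
  obtain ⟨a, b, H', ha, hH, hb, hab⟩ := hint t ⟨ht0, ht.2⟩ x ⟨hxl, hxr⟩ hpos
  have ha0 : 0 ≤ a := by
    refine ha.nonneg_of_eventually_le_left ?_
    filter_upwards [Ioo_mem_nhdsLT ht0] with s hs
    exact hle s ⟨hs.1.le, hs.2.le.trans ht.2⟩ x hx
  have hb0 : b ≤ 0 := by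
    refine IsLocalMax.second_deriv_nonpos (f := H t) ?_ hH hb
    filter_upwards [Ioo_mem_nhds hxl hxr] with y hy
    exact hle t ht y ⟨hy.1.le, hy.2.le⟩
  linarith

end MaximumPrinciple

section PartialDerivatives

variable {E : Type*} [NormedAddCommGroup E] [NormedSpace ℝ E]

/-- Time derivative of a function of `(t, x)`. -/
def partialT (f : ℝ × ℝ → E) (p : ℝ × ℝ) : E := fderiv ℝ f p (1, 0)

/-- Space derivative of a function of `(t, x)`. -/
def partialX (f : ℝ × ℝ → E) (p : ℝ × ℝ) : E := fderiv ℝ f p (0, 1)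

variable {f : ℝ × ℝ → E}

theorem contDiff_partialT (hf : ContDiff ℝ (⊤ : ℕ∞) f) : ContDiff ℝ (⊤ : ℕ∞) (partialT f) :=
  (hf.fderiv_right (m := (⊤ : ℕ∞)) (by simp)).clm_apply contDiff_const

theorem contDiff_partialX (hf : ContDiff ℝ (⊤ : ℕ∞) f) : ContDiff ℝ (⊤ : ℕ∞) (partialX f) :=
  (hf.fderiv_right (m := (⊤ : ℕ∞)) (by simp)).clm_apply contDiff_const

theorem hasDerivAt_partialT (hf : ContDiff ℝ (⊤ : ℕ∞) f) (t x : ℝ) :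
    HasDerivAt (fun s => f (s, x)) (partialT f (t, x)) t :=
  ((hf.differentiable (by simp)) (t, x)).hasFDerivAt.comp_hasDerivAt t
    ((hasDerivAt_id t).prodMk (hasDerivAt_const t x))

theorem hasDerivAt_partialX (hf : ContDiff ℝ (⊤ : ℕ∞) f) (t x : ℝ) :
    HasDerivAt (fun y => f (t, y)) (partialX f (t, x)) x :=
  ((hf.differentiable (by simp)) (t, x)).hasFDerivAt.comp_hasDerivAt x
    ((hasDerivAt_const x t).prodMk (hasDerivAt_id x))

theorem partialT_partialX (hf : ContDiff ℝ (⊤ : ℕ∞) f) (p : ℝ × ℝ) :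
    partialT (partialX f) p = partialX (partialT f) p := by
  have hd : DifferentiableAt ℝ (fderiv ℝ f) p :=
    (hf.fderiv_right (m := (⊤ : ℕ∞)) (by simp)).differentiable (by simp) p
  have key : ∀ a b : ℝ × ℝ,
      fderiv ℝ (fun q => fderiv ℝ f q a) p b = fderiv ℝ (fderiv ℝ f) p b a := fun a b => by
    rw [fderiv_clm_apply hd (by fun_prop)]
    simp
  have hsymm : IsSymmSndFDerivAt ℝ f p :=
    hf.contDiffAt.isSymmSndFDerivAt (by simpa using WithTop.coe_le_coe.2 (le_top (a := (2 : ℕ∞))))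
  unfold partialT partialX
  rw [key, key]
  exact hsymm _ _

end PartialDerivatives

section Linearization

variable {E : Type*} [NormedAddCommGroup E] [NormedSpace ℝ E]
  {g : E → E} {U : ℝ × ℝ → E}

theorem fderiv_of_reactionDiffusion (hU : ContDiff ℝ (⊤ : ℕ∞) U) (hg : Differentiable ℝ g)
    (hpde : ∀ p : ℝ × ℝ, 0 < p.1 → partialT U p = partialX (partialX U) p - g (U p))
    {p : ℝ × ℝ} (hp : 0 < p.1) (a : ℝ × ℝ) :
    fderiv ℝ (partialT U) p a =
      fderiv ℝ (partialX (partialX U)) p a - fderiv ℝ g (U p) (fderiv ℝ U p a) := by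
  have hev : partialT U =ᶠ[𝓝 p] fun q => partialX (partialX U) q - g (U q) := by
    filter_upwards [(isOpen_lt continuous_const continuous_fst).mem_nhds hp] with q hq
      using hpde q hq
  have h1 : DifferentiableAt ℝ (partialX (partialX U)) p :=
    (contDiff_partialX (contDiff_partialX hU)).differentiable (by simp) p
  have h2 : DifferentiableAt ℝ U p := hU.differentiable (by simp) p
  have h3 : HasFDerivAt (fun q => g (U q)) ((fderiv ℝ g (U p)).comp (fderiv ℝ U p)) p :=
    (hg (U p)).hasFDerivAt.comp p h2.hasFDerivAt
  rw [hev.fderiv_eq, (h1.hasFDerivAt.fun_sub h3).fderiv]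
  rfl

theorem partialT_partialX_of_reactionDiffusion (hU : ContDiff ℝ (⊤ : ℕ∞) U)
    (hg : Differentiable ℝ g)
    (hpde : ∀ p : ℝ × ℝ, 0 < p.1 → partialT U p = partialX (partialX U) p - g (U p))
    {p : ℝ × ℝ} (hp : 0 < p.1) :
    partialT (partialX U) p =
      partialX (partialX (partialX U)) p - fderiv ℝ g (U p) (partialX U p) := by
  rw [partialT_partialX hU]
  exact fderiv_of_reactionDiffusion hU hg hpde hp (0, 1)

theorem partialT_partialT_of_reactionDiffusion (hU : ContDiff ℝ (⊤ : ℕ∞) U)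
    (hg : Differentiable ℝ g)
    (hpde : ∀ p : ℝ × ℝ, 0 < p.1 → partialT U p = partialX (partialX U) p - g (U p))
    {p : ℝ × ℝ} (hp : 0 < p.1) :
    partialT (partialT U) p =
      partialX (partialX (partialT U)) p - fderiv ℝ g (U p) (partialT U p) := by
  have hcomm : partialX (partialX (partialT U)) p = partialT (partialX (partialX U)) p := by
    rw [partialT_partialX (contDiff_partialX hU),
      show partialT (partialX U) = partialX (partialT U) from funext (partialT_partialX hU)]
  rw [hcomm]
  exact fderiv_of_reactionDiffusion hU hg hpde hp (1, 0)

end Linearization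

section WeightedSquares

variable {E : Type*} [NormedAddCommGroup E] [InnerProductSpace ℝ E]

theorem hasDerivAt_mul_norm_sq {φ : ℝ → ℝ} {Y : ℝ → E} {φ' x : ℝ} {Y' : E}
    (hφ : HasDerivAt φ φ' x) (hY : HasDerivAt Y Y' x) :
    HasDerivAt (fun y => φ y * ‖Y y‖ ^ 2) (φ' * ‖Y x‖ ^ 2 + φ x * (2 * ⟪Y x, Y'⟫)) x :=
  hφ.mul hY.norm_sq

theorem hasDerivAt_deriv_mul_norm_sq {φ φ' : ℝ → ℝ} {Y Y' : ℝ → E} {φ'' x : ℝ} {Y'' : E}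
    (hφ : HasDerivAt φ (φ' x) x) (hφ' : HasDerivAt φ' φ'' x)
    (hY : HasDerivAt Y (Y' x) x) (hY' : HasDerivAt Y' Y'' x) :
    HasDerivAt (fun y => φ' y * ‖Y y‖ ^ 2 + φ y * (2 * ⟪Y y, Y' y⟫))
      (φ'' * ‖Y x‖ ^ 2 + 4 * φ' x * ⟪Y x, Y' x⟫
        + 2 * φ x * (‖Y' x‖ ^ 2 + ⟪Y x, Y''⟫)) x := by
  refine ((hφ'.mul hY.norm_sq).add (hφ.mul ((hY.inner ℝ hY').const_mul 2))).congr_deriv ?_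
  rw [real_inner_self_eq_norm_sq]
  ring

theorem time_derivative_estimate {η ηt ηx ηxx lam : ℝ} (h0 : 0 ≤ η) (h1 : η ≤ 1)
    (ht : ηt ≤ 1) (hx : |ηx| ≤ 1) (hxx : -1 ≤ ηxx) {y y₁ y₂ r : E}
    (hr : lam / 2 * ‖y‖ ^ 2 ≤ ⟪y, r⟫) :
    4 * η ^ 3 * ηt * ‖y‖ ^ 2 + η ^ 4 * (2 * ⟪y, y₂ - r⟫)
      - ((12 * η ^ 2 * ηx ^ 2 + 4 * η ^ 3 * ηxx) * ‖y‖ ^ 2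
        + 4 * (4 * η ^ 3 * ηx) * ⟪y, y₁⟫ + 2 * η ^ 4 * (‖y₁‖ ^ 2 + ⟪y, y₂⟫))
      ≤ 40 * η ^ 2 * ‖y‖ ^ 2 - lam * (η ^ 4 * ‖y‖ ^ 2) := by
  rw [inner_sub_right]
  have hcs : |⟪y, y₁⟫| ≤ ‖y‖ * ‖y₁‖ := abs_real_inner_le_norm y y₁
  have h3 : η ^ 3 ≤ η ^ 2 := pow_le_pow_of_le_one h0 h1 (by norm_num)
  have e1 : η ^ 3 * ηt * ‖y‖ ^ 2 ≤ η ^ 2 * ‖y‖ ^ 2 := by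
    gcongr
    nlinarith [pow_nonneg h0 3]
  have e2 : -(η ^ 3 * ηxx * ‖y‖ ^ 2) ≤ η ^ 2 * ‖y‖ ^ 2 := by
    rw [← neg_mul]
    gcongr
    nlinarith [pow_nonneg h0 3]
  have e3 : η ^ 4 * (lam / 2 * ‖y‖ ^ 2) ≤ η ^ 4 * ⟪y, r⟫ := by gcongr
  have e4 : -(ηx * ⟪y, y₁⟫) ≤ ‖y‖ * ‖y₁‖ := by
    refine (neg_le_abs _).trans ?_
    rw [abs_mul]
    calc |ηx| * |⟪y, y₁⟫| ≤ 1 * (‖y‖ * ‖y₁‖) := by gcongr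
      _ = _ := one_mul _
  have e5 : -(η ^ 3 * (ηx * ⟪y, y₁⟫)) ≤ η ^ 3 * (‖y‖ * ‖y₁‖) := by
    rw [← mul_neg]; gcongr
  nlinarith [sq_nonneg (η ^ 2 * ‖y₁‖ - 4 * (η * ‖y‖)),
    mul_nonneg (sq_nonneg (η * ηx)) (sq_nonneg ‖y‖)]

theorem space_derivative_estimate {η ηt ηx ηxx lam : ℝ} (h0 : 0 ≤ η) (h1 : η ≤ 1)
    (ht : ηt ≤ 1) (hx : |ηx| ≤ 1) (hxx : -1 ≤ ηxx) {z q z₂ r : E}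
    (hr : lam / 2 * ‖z‖ ^ 2 ≤ ⟪z, r⟫) :
    2 * η * ηt * ‖z‖ ^ 2 + η ^ 2 * (2 * ⟪z, z₂ - r⟫)
      - ((2 * ηx ^ 2 + 2 * η * ηxx) * ‖z‖ ^ 2
        + 4 * (2 * η * ηx) * ⟪z, q⟫ + 2 * η ^ 2 * (‖q‖ ^ 2 + ⟪z, z₂⟫))
      ≤ 20 * ‖z‖ ^ 2 - η ^ 2 * ‖q‖ ^ 2 - lam * (η ^ 2 * ‖z‖ ^ 2) := by
  rw [inner_sub_right]
  have hcs : |⟪z, q⟫| ≤ ‖z‖ * ‖q‖ := abs_real_inner_le_norm z q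
  have e1 : η * ηt * ‖z‖ ^ 2 ≤ 1 * ‖z‖ ^ 2 := by
    gcongr
    nlinarith
  have e2 : -(η * ηxx * ‖z‖ ^ 2) ≤ 1 * ‖z‖ ^ 2 := by
    rw [← neg_mul]
    gcongr
    nlinarith
  have e3 : η ^ 2 * (lam / 2 * ‖z‖ ^ 2) ≤ η ^ 2 * ⟪z, r⟫ := by gcongr
  have e4 : -(ηx * ⟪z, q⟫) ≤ ‖z‖ * ‖q‖ := by
    refine (neg_le_abs _).trans ?_
    rw [abs_mul]
    calc |ηx| * |⟪z, q⟫| ≤ 1 * (‖z‖ * ‖q‖) := by gcongr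
      _ = _ := one_mul _
  have e5 : -(η * (ηx * ⟪z, q⟫)) ≤ η * (‖z‖ * ‖q‖) := by
    rw [← mul_neg]; gcongr
  nlinarith [sq_nonneg (η * ‖q‖ - 4 * ‖z‖), mul_nonneg (sq_nonneg ηx) (sq_nonneg ‖z‖)]

end WeightedSquares

/-- Space-time cutoff vanishing at `t = 0` and at `x = ±ρ`. -/
def cutoff (ρ t x : ℝ) : ℝ := t / (1 + t) * (1 - x ^ 2 / ρ ^ 2)

section Cutoff

variable {ρ t x : ℝ}

theorem hasDerivAt_cutoff_time (ht : 0 < t) :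
    HasDerivAt (fun s => cutoff ρ s x) ((1 + t)⁻¹ ^ 2 * (1 - x ^ 2 / ρ ^ 2)) t := by
  have h : (1 + t) ≠ 0 := by positivity
  have := ((hasDerivAt_id t).div ((hasDerivAt_id t).const_add 1) h).mul_const (1 - x ^ 2 / ρ ^ 2)
  refine this.congr_deriv ?_
  simp only [id]
  field_simp
  ring

theorem hasDerivAt_cutoff_space :
    HasDerivAt (cutoff ρ t) (t / (1 + t) * (-(2 * x) / ρ ^ 2)) x := by
  refine (((((hasDerivAt_id x).pow 2).div_const (ρ ^ 2)).const_sub 1).const_mul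
    (t / (1 + t))).congr_deriv ?_
  simp
  ring

theorem hasDerivAt_cutoff_space' :
    HasDerivAt (fun y => t / (1 + t) * (-(2 * y) / ρ ^ 2)) (t / (1 + t) * (-2 / ρ ^ 2)) x := by
  refine (((((hasDerivAt_id x).const_mul 2).neg).div_const (ρ ^ 2)).const_mul
    (t / (1 + t))).congr_deriv ?_
  simp

theorem cutoff_bounds (hρ : 2 ≤ ρ) (ht : 0 ≤ t) (hx : |x| ≤ ρ) :
    0 ≤ cutoff ρ t x ∧ cutoff ρ t x ≤ 1 ∧ (1 + t)⁻¹ ^ 2 * (1 - x ^ 2 / ρ ^ 2) ≤ 1 ∧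
      |t / (1 + t) * (-(2 * x) / ρ ^ 2)| ≤ 1 ∧ -1 ≤ t / (1 + t) * (-2 / ρ ^ 2) := by
  have hρ0 : 0 < ρ := by linarith
  have hτ0 : 0 ≤ t / (1 + t) := by positivity
  have hτ1 : t / (1 + t) ≤ 1 := by rw [div_le_one (by positivity)]; linarith
  have hxρ : x ^ 2 / ρ ^ 2 ≤ 1 := by
    rw [div_le_one (by positivity)]
    exact sq_le_sq.2 (by rwa [abs_of_pos hρ0])
  have hxρ0 : 0 ≤ x ^ 2 / ρ ^ 2 := by positivity
  have hinv : (1 + t)⁻¹ ^ 2 ≤ 1 := by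
    apply pow_le_one₀ (by positivity)
    exact inv_le_one_of_one_le₀ (by linarith)
  refine ⟨mul_nonneg hτ0 (by linarith), ?_, ?_, ?_, ?_⟩
  · exact mul_le_one₀ hτ1 (by linarith) (by linarith)
  · exact mul_le_one₀ hinv (by linarith) (by linarith)
  · rw [abs_mul, abs_of_nonneg hτ0]
    refine mul_le_one₀ hτ1 (abs_nonneg _) ?_
    rw [abs_div, abs_neg, abs_mul, abs_of_pos (by positivity : 0 < ρ ^ 2),
      div_le_one (by positivity)]
    norm_num
    nlinarith
  · have : 2 / ρ ^ 2 ≤ 1 := by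
      rw [div_le_one (by positivity)]; nlinarith
    have h2 : 0 ≤ 2 / ρ ^ 2 := by positivity
    rw [neg_div, mul_neg]
    nlinarith [mul_le_one₀ hτ1 h2 this]

end Cutoff

section Potential

theorem fderiv_gradient_inner {V : Euc k → ℝ} (hV : ContDiff ℝ (⊤ : ℕ∞) V) (y w : Euc k) :
    ⟪w, fderiv ℝ (gradient V) y w⟫ = iteratedFDeriv ℝ 2 V y ![w, w] := by
  have hd : DifferentiableAt ℝ (fderiv ℝ V) y :=
    (hV.fderiv_right (m := (⊤ : ℕ∞)) (by simp)).differentiable (by simp) y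
  have h : HasFDerivAt (gradient V)
      (((InnerProductSpace.toDual ℝ (Euc k)).symm.toContinuousLinearEquiv.toContinuousLinearMap).comp
        (fderiv ℝ (fderiv ℝ V) y)) y :=
    ((InnerProductSpace.toDual ℝ (Euc k)).symm.toContinuousLinearEquiv.hasFDerivAt).comp y
      hd.hasFDerivAt
  rw [h.fderiv, iteratedFDeriv_two_apply, real_inner_comm]
  simp [InnerProductSpace.toDual_symm_apply]

theorem contDiff_gradient {V : Euc k → ℝ} (hV : ContDiff ℝ (⊤ : ℕ∞) V) :
    ContDiff ℝ (⊤ : ℕ∞) (gradient V) :=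
  (InnerProductSpace.toDual ℝ (Euc k)).symm.toContinuousLinearEquiv.contDiff.comp
    (hV.fderiv_right (m := (⊤ : ℕ∞)) (by simp))

theorem gradient_well (P : MultiWell k) {σ : Euc k} (hσ : σ ∈ P.wells) :
    gradient P.V σ = 0 := by
  have hmin : IsLocalMin P.V σ := Eventually.of_forall fun y => by
    rw [(P.zero_iff σ).2 hσ]; exact P.nonneg y
  simp [gradient, hmin.fderiv_eq_zero]

/-- A lower bound on the symmetric part of `Dg` gives monotonicity of `g` along rays from a zero. -/
theorem inner_sub_ge_of_fderiv_ge {E : Type*} [NormedAddCommGroup E] [InnerProductSpace ℝ E]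
    {g : E → E} (hg : Differentiable ℝ g) {σ : E} {r c : ℝ} (hσ : g σ = 0)
    (hc : ∀ y ∈ ball σ r, ∀ w, c * ‖w‖ ^ 2 ≤ ⟪w, fderiv ℝ g y w⟫) {y : E} (hy : y ∈ ball σ r) :
    c * ‖y - σ‖ ^ 2 ≤ ⟪y - σ, g y⟫ := by
  set w := y - σ
  have hline : ∀ s : ℝ, HasDerivAt (fun s : ℝ => σ + s • w) w s := fun s => by
    simpa using ((hasDerivAt_id s).smul_const w).const_add σ
  have hφ : ∀ s : ℝ, HasDerivAt (fun s : ℝ => ⟪w, g (σ + s • w)⟫)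
      ⟪w, fderiv ℝ g (σ + s • w) w⟫ s := fun s => by
    simpa using (hasDerivAt_const s w).inner ℝ
      ((hg (σ + s • w)).hasFDerivAt.comp_hasDerivAt s (hline s))
  obtain ⟨s, hs, hslope⟩ := exists_hasDerivAt_eq_slope (fun s : ℝ => ⟪w, g (σ + s • w)⟫)
    (fun s => ⟪w, fderiv ℝ g (σ + s • w) w⟫) zero_lt_one
    (fun s _ => (hφ s).continuousAt.continuousWithinAt) (fun s _ => hφ s)
  have hmem : σ + s • w ∈ ball σ r := by
    have : ‖s • w‖ ≤ ‖w‖ := by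
      rw [norm_smul, Real.norm_of_nonneg hs.1.le]
      exact mul_le_of_le_one_left (norm_nonneg _) hs.2.le
    rw [mem_ball_iff_norm] at hy ⊢
    simpa using this.trans_lt hy
  have := hc _ hmem w
  rw [hslope] at this
  simpa [hσ, w] using this

theorem exists_lower_bound (P : MultiWell k) : ∃ lam > 0, ∀ σ ∈ P.wells, lam ≤ P.lamm σ := by
  have hne : P.wells.Nonempty := Finset.card_pos.1 (by have := P.two_le_card; omega)
  obtain ⟨σ, hσ, hmin⟩ := P.wells.exists_min_image P.lamm hne
  exact ⟨P.lamm σ, P.lamm_pos σ hσ, hmin⟩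

/-- Around the wells, `∇V` grows at most linearly and `V` at most quadratically. -/
theorem exists_upper_bound (P : MultiWell k) (μ : ℝ) :
    ∃ Lam > 0, ∀ σ ∈ P.wells, ∀ y ∈ ball σ μ,
      ‖gradient P.V y‖ ≤ Lam * ‖y - σ‖ ∧ P.V y ≤ Lam * ‖y - σ‖ ^ 2 := by
  have hg := contDiff_gradient P.smooth
  have hK : IsCompact (⋃ σ ∈ P.wells, closedBall σ μ) :=
    P.wells.finite_toSet.isCompact_biUnion fun σ _ => isCompact_closedBall σ μ
  obtain ⟨C, hC⟩ := hK.exists_bound_of_continuousOn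
    (hg.continuous_fderiv (by simp)).continuousOn
  refine ⟨|C| + 1, by positivity, fun σ hσ y hy => ?_⟩
  have hyμ : ‖y - σ‖ < μ := mem_ball_iff_norm.1 hy
  have hgrad : ∀ z ∈ closedBall σ ‖y - σ‖, ‖gradient P.V z‖ ≤ (|C| + 1) * ‖y - σ‖ := by
    intro z hz
    have := (convex_closedBall σ ‖y - σ‖).norm_image_sub_le_of_norm_fderiv_le (𝕜 := ℝ)
      (f := gradient P.V) (C := |C| + 1)
      (fun p _ => hg.differentiable (by simp) p)
      (fun p hp => (hC p (mem_biUnion hσ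
        (closedBall_subset_closedBall hyμ.le hp))).trans
        ((le_abs_self C).trans (by linarith))) (mem_closedBall_self (norm_nonneg _)) hz
    rw [gradient_well P hσ, sub_zero] at this
    exact this.trans (by gcongr; exact mem_closedBall_iff_norm.1 hz)
  have hmem : y ∈ closedBall σ ‖y - σ‖ := mem_closedBall_iff_norm.2 le_rfl
  refine ⟨hgrad y hmem, ?_⟩
  have := (convex_closedBall σ ‖y - σ‖).norm_image_sub_le_of_norm_fderiv_le (𝕜 := ℝ)
    (f := P.V) (C := (|C| + 1) * ‖y - σ‖)
    (fun p _ => P.smooth.differentiable (by simp) p)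
    (fun p hp => by
      have := hgrad p hp
      rwa [gradient, LinearIsometryEquiv.norm_map] at this)
    (mem_closedBall_self (norm_nonneg _)) hmem
  rw [(P.zero_iff σ).2 hσ, sub_zero, Real.norm_of_nonneg (P.nonneg y)] at this
  linarith

/-- A continuous map on a connected set staying close to the wells is close to a single one. -/
theorem exists_well_of_isPreconnected {P : MultiWell k} {μ₀ : ℝ} (hμ : GoodRadius P μ₀)
    {X : Type*} [TopologicalSpace X] {S : Set X} (hS : IsPreconnected S) {U : X → Euc k}
    (hU : ContinuousOn U S) (hclose : ∀ p ∈ S, infDist (U p) (P.wells : Set (Euc k)) < μ₀)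
    {p₀ : X} (hp₀ : p₀ ∈ S) : ∃ σ ∈ P.wells, ∀ p ∈ S, U p ∈ ball σ μ₀ := by
  have hne : (P.wells : Set (Euc k)).Nonempty := by
    rw [Finset.coe_nonempty, ← Finset.card_pos]; have := P.two_le_card; omega
  have hex : ∀ p ∈ S, ∃ σ ∈ P.wells, U p ∈ ball σ μ₀ := fun p hp => by
    obtain ⟨σ, hσ, h⟩ := (infDist_lt_iff hne).1 (hclose p hp)
    exact ⟨σ, hσ, h⟩
  obtain ⟨σ, hσ, hσ₀⟩ := hex p₀ hp₀
  refine ⟨σ, hσ, fun p hp => ?_⟩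
  have hopen : IsOpen (⋃ σ' ∈ P.wells.erase σ, ball σ' μ₀) :=
    isOpen_biUnion fun _ _ => isOpen_ball
  have hsub := (hS.image U hU).subset_left_of_subset_union (isOpen_ball (x := σ) (ε := μ₀)) hopen
    (disjoint_iUnion₂_right.2 fun σ' hσ' =>
      hμ.2.1 σ hσ σ' (Finset.mem_of_mem_erase hσ') (Finset.ne_of_mem_erase hσ').symm) ?_
    ⟨U p₀, mem_image_of_mem U hp₀, hσ₀⟩
  · exact hsub (mem_image_of_mem U hp)
  · rintro _ ⟨q, hq, rfl⟩
    obtain ⟨σ', hσ', h⟩ := hex q hq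
    by_cases h' : σ' = σ
    · exact Or.inl (h' ▸ h)
    · exact Or.inr (mem_biUnion (Finset.mem_coe.2 (Finset.mem_erase.2 ⟨h', hσ'⟩)) h)

end Potential

section InteriorEstimate

variable {E : Type*} [NormedAddCommGroup E] [InnerProductSpace ℝ E]

/-- Supersolution of `∂ₜG − ∂ₓₓG = −κ²G` dominating the parabolic boundary. -/
def barrier (κ ρ t x : ℝ) : ℝ :=
  Real.exp (-(κ ^ 2 * t)) + Real.cosh (κ * x) / Real.cosh (κ * ρ)

/-- Bernstein-type quantity controlling `∂ₜU`, `∂ₓU` and `U − σ`. -/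
def bernsteinQuantity (U : ℝ × ℝ → E) (σ : E) (B ρ t x : ℝ) : ℝ :=
  cutoff ρ t x ^ 4 * ‖partialT U (t, x)‖ ^ 2 + 80 * (cutoff ρ t x ^ 2 * ‖partialX U (t, x)‖ ^ 2)
    + B * ‖U (t, x) - σ‖ ^ 2

theorem hasDerivAt_barrier_time (κ ρ t x : ℝ) :
    HasDerivAt (fun s => barrier κ ρ s x) (-(κ ^ 2 * Real.exp (-(κ ^ 2 * t)))) t := by
  refine ((((hasDerivAt_id t).const_mul (κ ^ 2)).neg.exp).add_const
    (Real.cosh (κ * x) / Real.cosh (κ * ρ))).congr_deriv ?_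
  simp
  ring

theorem hasDerivAt_barrier_space (κ ρ t x : ℝ) :
    HasDerivAt (barrier κ ρ t) (κ * Real.sinh (κ * x) / Real.cosh (κ * ρ)) x := by
  refine ((((hasDerivAt_id x).const_mul κ).cosh.div_const (Real.cosh (κ * ρ))).const_add
    (Real.exp (-(κ ^ 2 * t)))).congr_deriv ?_
  simp
  ring

theorem hasDerivAt_barrier_space' (κ ρ x : ℝ) :
    HasDerivAt (fun y => κ * Real.sinh (κ * y) / Real.cosh (κ * ρ))
      (κ ^ 2 * (Real.cosh (κ * x) / Real.cosh (κ * ρ))) x := by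
  refine ((((hasDerivAt_id x).const_mul κ).sinh.const_mul κ).div_const
    (Real.cosh (κ * ρ))).congr_deriv ?_
  simp
  ring

theorem bernsteinQuantity_le_barrier {g : E → E} {U : ℝ × ℝ → E} {σ : E} {Lam κ μ ρ T : ℝ}
    (hU : ContDiff ℝ (⊤ : ℕ∞) U) (hg : Differentiable ℝ g)
    (hpde : ∀ p : ℝ × ℝ, 0 < p.1 → partialT U p = partialX (partialX U) p - g (U p))
    (hκ : 0 < κ) (hρ : 2 ≤ ρ) (hT : 0 ≤ T) (hσ : g σ = 0)
    (hlow : ∀ y ∈ ball σ μ, ∀ w, κ ^ 2 * ‖w‖ ^ 2 ≤ ⟪w, fderiv ℝ g y w⟫)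
    (hup : ∀ y ∈ ball σ μ, ‖g y‖ ≤ Lam * ‖y - σ‖)
    (hball : ∀ t ∈ Icc 0 T, ∀ x ∈ Icc (-ρ) ρ, U (t, x) ∈ ball σ μ) :
    ∀ t ∈ Icc 0 T, ∀ x ∈ Icc (-ρ) ρ,
      bernsteinQuantity U σ (800 + 80 * Lam ^ 2 / κ ^ 2) ρ t x ≤
        (800 + 80 * Lam ^ 2 / κ ^ 2) * μ ^ 2 * barrier κ ρ t x := by
  set B := 800 + 80 * Lam ^ 2 / κ ^ 2 with hB
  have hB0 : 0 < B := by positivity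
  have hBκ : B * κ ^ 2 = 800 * κ ^ 2 + 80 * Lam ^ 2 := by rw [hB]; field_simp
  have hUt := contDiff_partialT hU
  have hUx := contDiff_partialX hU
  have hw : ∀ t ∈ Icc 0 T, ∀ x ∈ Icc (-ρ) ρ, B * ‖U (t, x) - σ‖ ^ 2 ≤ B * μ ^ 2 := by
    intro t ht x hx
    have := (mem_ball_iff_norm.1 (hball t ht x hx)).le
    gcongr
  have hcosh : Real.cosh (κ * ρ) ≠ 0 := (Real.cosh_pos _).ne'
  have hlat : ∀ t ∈ Icc 0 T, ∀ x ∈ Icc (-ρ) ρ, cutoff ρ t x = 0 → 1 ≤ barrier κ ρ t x →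
      bernsteinQuantity U σ B ρ t x - B * μ ^ 2 * barrier κ ρ t x ≤ 0 := by
    intro t ht x hx h0 h1
    have h2 := hw t ht x hx
    have h3 : 0 ≤ B * μ ^ 2 := by positivity
    simp only [bernsteinQuantity, h0]
    nlinarith
  have hρ0 : ρ ≠ 0 := by positivity
  suffices h : ∀ t ∈ Icc 0 T, ∀ x ∈ Icc (-ρ) ρ,
      bernsteinQuantity U σ B ρ t x - B * μ ^ 2 * barrier κ ρ t x ≤ 0 from
    fun t ht x hx => sub_nonpos.1 (h t ht x hx)
  refine nonpos_of_parabolic ?_ ?_ ?_ ?_ ?_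
  · have hne : ∀ p ∈ Icc 0 T ×ˢ Icc (-ρ) ρ, 1 + p.1 ≠ 0 := fun p hp => by
      have := hp.1.1
      positivity
    have hc1 := hU.continuous
    have hc2 := hUt.continuous
    have hc3 := hUx.continuous
    have hcut : ContinuousOn (fun p : ℝ × ℝ => cutoff ρ p.1 p.2) (Icc 0 T ×ˢ Icc (-ρ) ρ) :=
      (continuousOn_fst.div (by fun_prop) hne).mul (by fun_prop)
    have hbar : Continuous (fun p : ℝ × ℝ => barrier κ ρ p.1 p.2) := by
      unfold barrier; fun_prop
    unfold Function.uncurry bernsteinQuantity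
    fun_prop
  · intro x hx
    refine hlat 0 ⟨le_rfl, hT⟩ x hx (by simp [cutoff]) ?_
    have : 0 ≤ Real.cosh (κ * x) / Real.cosh (κ * ρ) :=
      div_nonneg (Real.cosh_pos _).le (Real.cosh_pos _).le
    simpa [barrier] using this
  · intro t ht
    refine hlat t ht _ ⟨le_rfl, by linarith⟩ (by simp [cutoff, hρ0]) ?_
    simp [barrier, hcosh, (Real.exp_pos _).le]
  · intro t ht
    refine hlat t ht _ ⟨by linarith, le_rfl⟩ (by simp [cutoff, hρ0]) ?_
    simp [barrier, hcosh, (Real.exp_pos _).le]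
  intro t ht x hx hpos
  have hxρ : |x| ≤ ρ := abs_le.2 ⟨hx.1.le, hx.2.le⟩
  obtain ⟨η0, η1, hηt, hηx, hηxx⟩ := cutoff_bounds (t := t) hρ ht.1.le hxρ
  have hηs : ∀ y, HasDerivAt (cutoff ρ t) (t / (1 + t) * (-(2 * y) / ρ ^ 2)) y :=
    fun y => hasDerivAt_cutoff_space
  have hUb := hball t ⟨ht.1.le, ht.2⟩ x ⟨hx.1.le, hx.2.le⟩
  have hp : 0 < ((t, x) : ℝ × ℝ).1 := ht.1
  have dt := (((hasDerivAt_mul_norm_sq ((hasDerivAt_cutoff_time (ρ := ρ) (x := x) ht.1).fun_pow 4)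
    (hasDerivAt_partialT hUt t x)).add ((hasDerivAt_mul_norm_sq
      ((hasDerivAt_cutoff_time (ρ := ρ) (x := x) ht.1).fun_pow 2)
        (hasDerivAt_partialT hUx t x)).const_mul 80)).add
    (hasDerivAt_mul_norm_sq (hasDerivAt_const t B)
      ((hasDerivAt_partialT hU t x).sub_const σ))).sub
    ((hasDerivAt_barrier_time κ ρ t x).const_mul (B * μ ^ 2))
  have dx := fun y => (((hasDerivAt_mul_norm_sq ((hηs y).fun_pow 4)
    (hasDerivAt_partialX hUt t y)).add ((hasDerivAt_mul_norm_sq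
      ((hηs y).fun_pow 2) (hasDerivAt_partialX hUx t y)).const_mul 80)).add
    (hasDerivAt_mul_norm_sq (hasDerivAt_const y B)
      ((hasDerivAt_partialX hU t y).sub_const σ))).sub
    ((hasDerivAt_barrier_space κ ρ t y).const_mul (B * μ ^ 2))
  have dxx := (((hasDerivAt_deriv_mul_norm_sq ((hηs x).fun_pow 4)
    ((((hηs x).fun_pow (4 - 1)).const_mul ((4 : ℕ) : ℝ)).mul hasDerivAt_cutoff_space')
    (hasDerivAt_partialX hUt t x) (hasDerivAt_partialX (contDiff_partialX hUt) t x)).add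
    ((hasDerivAt_deriv_mul_norm_sq ((hηs x).fun_pow 2)
    ((((hηs x).fun_pow (2 - 1)).const_mul ((2 : ℕ) : ℝ)).mul hasDerivAt_cutoff_space')
    (hasDerivAt_partialX hUx t x) (hasDerivAt_partialX (contDiff_partialX hUx) t x)).const_mul
      80)).add
    (hasDerivAt_deriv_mul_norm_sq (hasDerivAt_const x B) (hasDerivAt_const x (0 : ℝ))
      ((hasDerivAt_partialX hU t x).sub_const σ) (hasDerivAt_partialX hUx t x))).sub
    ((hasDerivAt_barrier_space' κ ρ x).const_mul (B * μ ^ 2))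
  refine ⟨_, _, _, dt, dx, dxx, ?_⟩
  have hUt_eq := hpde (t, x) hp
  rw [partialT_partialT_of_reactionDiffusion hU hg hpde hp,
    partialT_partialX_of_reactionDiffusion hU hg hpde hp]
  have hlow' := hlow _ hUb
  have est1 := time_derivative_estimate (lam := 2 * κ ^ 2) η0 η1 hηt hηx hηxx
    (y := partialT U (t, x)) (y₁ := partialX (partialT U) (t, x))
    (y₂ := partialX (partialX (partialT U)) (t, x)) (r := fderiv ℝ g (U (t, x)) (partialT U (t, x)))
    (by simpa using hlow' _)
  have est2 := space_derivative_estimate (lam := 2 * κ ^ 2) η0 η1 hηt hηx hηxx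
    (z := partialX U (t, x)) (q := partialX (partialX U) (t, x))
    (z₂ := partialX (partialX (partialX U)) (t, x))
    (r := fderiv ℝ g (U (t, x)) (partialX U (t, x))) (by simpa using hlow' _)
  have hin : κ ^ 2 * ‖U (t, x) - σ‖ ^ 2 ≤ ⟪U (t, x) - σ, g (U (t, x))⟫ :=
    inner_sub_ge_of_fderiv_ge hg hσ hlow hUb
  have est3 : ⟪U (t, x) - σ, partialT U (t, x)⟫ - ⟪U (t, x) - σ, partialX (partialX U) (t, x)⟫
      ≤ -(κ ^ 2 * ‖U (t, x) - σ‖ ^ 2) := by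
    rw [hUt_eq, inner_sub_right]
    linear_combination hin
  have est4 : ‖partialT U (t, x)‖ ^ 2 ≤
      2 * ‖partialX (partialX U) (t, x)‖ ^ 2 + 2 * (Lam ^ 2 * ‖U (t, x) - σ‖ ^ 2) := by
    have h1 : ‖partialT U (t, x)‖ ≤ ‖partialX (partialX U) (t, x)‖ + Lam * ‖U (t, x) - σ‖ := by
      rw [hUt_eq]
      exact (norm_sub_le _ _).trans (by gcongr; exact hup _ hUb)
    have h2 := pow_le_pow_left₀ (norm_nonneg _) h1 2
    linear_combination h2 + sq_nonneg (‖partialX (partialX U) (t, x)‖ - Lam * ‖U (t, x) - σ‖)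
  simp only [bernsteinQuantity, barrier] at hpos
  generalize hη : cutoff ρ t x = η at *
  have est5 : η ^ 2 * ‖partialT U (t, x)‖ ^ 2 ≤
      2 * (η ^ 2 * ‖partialX (partialX U) (t, x)‖ ^ 2) + 2 * (Lam ^ 2 * ‖U (t, x) - σ‖ ^ 2) := by
    have : η ^ 2 ≤ 1 := pow_le_one₀ η0 η1
    have h3 : η ^ 2 * (2 * (Lam ^ 2 * ‖U (t, x) - σ‖ ^ 2)) ≤ 2 * (Lam ^ 2 * ‖U (t, x) - σ‖ ^ 2) :=
      mul_le_of_le_one_left (by positivity) this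
    linear_combination η ^ 2 * est4 + h3
  have est6 := mul_le_mul_of_nonneg_left est3 hB0.le
  have hB' : 800 * ‖partialX U (t, x)‖ ^ 2 ≤ B * ‖partialX U (t, x)‖ ^ 2 := by
    gcongr
    rw [hB]
    exact le_add_of_nonneg_right (by positivity)
  have hy : 0 ≤ κ ^ 2 * (η ^ 4 * ‖partialT U (t, x)‖ ^ 2) := by positivity
  have hz : 0 ≤ κ ^ 2 * (η ^ 2 * ‖partialX U (t, x)‖ ^ 2) := by positivity
  have hB'' : B * κ ^ 2 * ‖U (t, x) - σ‖ ^ 2 =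
      800 * κ ^ 2 * ‖U (t, x) - σ‖ ^ 2 + 80 * Lam ^ 2 * ‖U (t, x) - σ‖ ^ 2 := by
    rw [hBκ]; ring
  have hw' : 0 ≤ κ ^ 2 * ‖U (t, x) - σ‖ ^ 2 := by positivity
  simp only [Pi.mul_apply, Nat.cast_ofNat, Nat.reduceSub, pow_one, Nat.cast_one, hη]
  have est3' : B * (2 * ⟪U (t, x) - σ, partialT U (t, x)⟫)
      - 2 * B * (‖partialX U (t, x)‖ ^ 2 + ⟪U (t, x) - σ, partialX (partialX U) (t, x)⟫)
      ≤ -(1600 * ‖partialX U (t, x)‖ ^ 2) - 2 * (B * κ ^ 2 * ‖U (t, x) - σ‖ ^ 2) := by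
    linear_combination 2 * est6 + 2 * hB'
  have hsum := add_le_add (add_le_add est1 (mul_le_mul_of_nonneg_left est2 (by norm_num :
    (0 : ℝ) ≤ 80))) est3'
  have hdecay : 40 * η ^ 2 * ‖partialT U (t, x)‖ ^ 2
      - 2 * κ ^ 2 * (η ^ 4 * ‖partialT U (t, x)‖ ^ 2)
      + 80 * (20 * ‖partialX U (t, x)‖ ^ 2 - η ^ 2 * ‖partialX (partialX U) (t, x)‖ ^ 2
        - 2 * κ ^ 2 * (η ^ 2 * ‖partialX U (t, x)‖ ^ 2))
      + (-(1600 * ‖partialX U (t, x)‖ ^ 2) - 2 * (B * κ ^ 2 * ‖U (t, x) - σ‖ ^ 2))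
      ≤ -(κ ^ 2 * (η ^ 4 * ‖partialT U (t, x)‖ ^ 2 + 80 * (η ^ 2 * ‖partialX U (t, x)‖ ^ 2)
        + B * ‖U (t, x) - σ‖ ^ 2)) := by
    linear_combination 40 * est5 + hy + 80 * hz + 800 * hw' - hB''
  have hpos' := mul_pos (pow_pos hκ 2) hpos
  have hlt := (hsum.trans hdecay).trans_lt (sub_pos.1 (hpos'.trans_eq (by ring :
    _ = -(κ ^ 2 * (B * μ ^ 2 * (Real.exp (-(κ ^ 2 * t))
        + Real.cosh (κ * x) / Real.cosh (κ * ρ))))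
      - -(κ ^ 2 * (η ^ 4 * ‖partialT U (t, x)‖ ^ 2 + 80 * (η ^ 2 * ‖partialX U (t, x)‖ ^ 2)
        + B * ‖U (t, x) - σ‖ ^ 2)))))
  linear_combination hlt

end InteriorEstimate

section Rescaling

variable {E : Type*} [NormedAddCommGroup E] [NormedSpace ℝ E] {f : ℝ × ℝ → E}

theorem contDiff_rescale (hf : ContDiff ℝ (⊤ : ℕ∞) f) (a b c : ℝ) :
    ContDiff ℝ (⊤ : ℕ∞) fun p : ℝ × ℝ => f (a * p.1, c + b * p.2) :=
  hf.comp (by fun_prop)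

theorem partialT_rescale (hf : ContDiff ℝ (⊤ : ℕ∞) f) (a b c : ℝ) (p : ℝ × ℝ) :
    partialT (fun p : ℝ × ℝ => f (a * p.1, c + b * p.2)) p =
      a • partialT f (a * p.1, c + b * p.2) := by
  have h1 := hasDerivAt_partialT (contDiff_rescale hf a b c) p.1 p.2
  have h2 : HasDerivAt (fun s => a * s) a p.1 := by
    simpa using (hasDerivAt_id p.1).const_mul a
  exact h1.unique ((hasDerivAt_partialT hf (a * p.1) (c + b * p.2)).scomp p.1 h2)

theorem partialX_rescale (hf : ContDiff ℝ (⊤ : ℕ∞) f) (a b c : ℝ) (p : ℝ × ℝ) :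
    partialX (fun p : ℝ × ℝ => f (a * p.1, c + b * p.2)) p =
      b • partialX f (a * p.1, c + b * p.2) := by
  have h1 := hasDerivAt_partialX (contDiff_rescale hf a b c) p.1 p.2
  have h2 : HasDerivAt (fun s => c + b * s) b p.2 := by
    simpa using ((hasDerivAt_id p.2).const_mul b).const_add c
  exact h1.unique (HasDerivAt.scomp (g₁ := fun y => f (a * p.1, y)) p.2
    (hasDerivAt_partialX hf (a * p.1) (c + b * p.2)) h2)

theorem partialX_const_smul (hf : ContDiff ℝ (⊤ : ℕ∞) f) (b : ℝ) (p : ℝ × ℝ) :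
    partialX (fun p => b • f p) p = b • partialX f p := by
  have h := ((hf.differentiable (by simp)) p).hasFDerivAt.fun_const_smul b
  simp [partialX, h.fderiv]

/-- A solution at scale `ε`, recentred and rescaled parabolically, solves the system at scale `1`. -/
theorem IsSolution.rescale {P : MultiWell k} {ε : ℝ} (hε : 0 < ε) {v : ℝ → ℝ → Euc k}
    (hv : IsSolution P ε v) (x₀ : ℝ) {p : ℝ × ℝ} (hp : 0 < p.1) :
    partialT (fun p : ℝ × ℝ => Function.uncurry v (ε ^ 2 * p.1, x₀ + ε * p.2)) p =
      partialX (partialX fun p : ℝ × ℝ => Function.uncurry v (ε ^ 2 * p.1, x₀ + ε * p.2)) p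
        - gradient P.V (Function.uncurry v (ε ^ 2 * p.1, x₀ + ε * p.2)) := by
  obtain ⟨hsm, hpde⟩ := hv
  have hx : partialX (fun p : ℝ × ℝ => Function.uncurry v (ε ^ 2 * p.1, x₀ + ε * p.2)) =
      fun p => ε • partialX (Function.uncurry v) (ε ^ 2 * p.1, x₀ + ε * p.2) :=
    funext fun p => partialX_rescale hsm _ _ _ p
  rw [partialT_rescale hsm, hx,
    partialX_const_smul (contDiff_rescale (contDiff_partialX hsm) _ _ _),
    partialX_rescale (contDiff_partialX hsm)]
  have h := hpde (ε ^ 2 * p.1) (x₀ + ε * p.2) (by positivity)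
  have hd : deriv (v (ε ^ 2 * p.1)) = fun y => partialX (Function.uncurry v) (ε ^ 2 * p.1, y) :=
    funext fun y => (hasDerivAt_partialX hsm _ y).deriv
  rw [iteratedDeriv_succ, iteratedDeriv_one, hd,
    (hasDerivAt_partialX (contDiff_partialX hsm) _ _).deriv,
    show deriv (fun s => v s (x₀ + ε * p.2)) (ε ^ 2 * p.1) =
      partialT (Function.uncurry v) (ε ^ 2 * p.1, x₀ + ε * p.2) from
      (hasDerivAt_partialT hsm _ _).deriv, sub_eq_iff_eq_add] at h
  rw [h, smul_add, smul_smul, smul_smul, mul_neg, mul_inv_cancel₀ (by positivity), Function.uncurry]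
  simp only [neg_smul, one_smul, ← sq]
  abel

end Rescaling

theorem cosh_ratio_le {κ ρ x : ℝ} (hκ : 0 < κ) (hx : |x| ≤ ρ / 2) :
    Real.cosh (κ * x) / Real.cosh (κ * ρ) ≤ 2 * Real.exp (-(κ / 2 * ρ)) := by
  rw [div_le_iff₀ (Real.cosh_pos _)]
  have h1 : Real.cosh (κ * x) ≤ Real.exp (κ / 2 * ρ) := by
    have : |κ * x| ≤ κ / 2 * ρ := by
      rw [abs_mul, abs_of_pos hκ]; nlinarith
    obtain ⟨ha, hb⟩ := abs_le.1 this
    rw [Real.cosh_eq]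
    have := Real.exp_le_exp.2 hb
    have := Real.exp_le_exp.2 (by linarith : -(κ * x) ≤ κ / 2 * ρ)
    linarith
  have h2 : Real.exp (κ * ρ) / 2 ≤ Real.cosh (κ * ρ) := by
    rw [Real.cosh_eq]
    have := Real.exp_pos (-(κ * ρ))
    linarith
  calc Real.cosh (κ * x) ≤ Real.exp (κ / 2 * ρ) := h1
    _ = 2 * Real.exp (-(κ / 2 * ρ)) * (Real.exp (κ * ρ) / 2) := by
      rw [show κ / 2 * ρ = -(κ / 2 * ρ) + κ * ρ by ring, Real.exp_add]; ring_nf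
    _ ≤ _ := by gcongr

theorem barrier_le {κ ρ t x : ℝ} (hκ : 0 < κ) (hρ : 0 < ρ) (ht : 1 ≤ t) (hx : |x| ≤ ρ / 2) :
    barrier κ ρ t x ≤
      Real.exp (-(κ ^ 2 * t)) + 64 / κ ^ 2 * (t / ρ ^ 2 * Real.exp (-(κ / 4 * ρ))) := by
  refine add_le_add_right ((cosh_ratio_le hκ hx).trans ?_) _
  have h1 : (κ / 4 * ρ) ^ 2 / 2 ≤ Real.exp (κ / 4 * ρ) := by
    have := Real.quadratic_le_exp_of_nonneg (x := κ / 4 * ρ) (by positivity)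
    have : 0 ≤ κ / 4 * ρ := by positivity
    linarith
  have h2 : 1 ≤ 32 / κ ^ 2 / ρ ^ 2 * Real.exp (κ / 4 * ρ) := by
    calc (1 : ℝ) = 32 / κ ^ 2 / ρ ^ 2 * ((κ / 4 * ρ) ^ 2 / 2) := by field_simp; norm_num
      _ ≤ _ := by gcongr
  calc 2 * Real.exp (-(κ / 2 * ρ)) = 2 * (1 * 1 * Real.exp (-(κ / 2 * ρ))) := by ring
    _ ≤ 2 * (32 / κ ^ 2 / ρ ^ 2 * Real.exp (κ / 4 * ρ) * t * Real.exp (-(κ / 2 * ρ))) := by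
      gcongr
    _ = 64 / κ ^ 2 * (t / ρ ^ 2 * (Real.exp (κ / 4 * ρ) * Real.exp (-(κ / 2 * ρ)))) := by ring
    _ = _ := by rw [← Real.exp_add]; ring_nf

/-- Away from the parabolic boundary, the Bernstein quantity controls all derivatives. -/
theorem sq_norms_le_bernsteinQuantity {E : Type*} [NormedAddCommGroup E] [InnerProductSpace ℝ E]
    {U : ℝ × ℝ → E} {σ : E} {B Lam ρ t x : ℝ} (hB : 1 ≤ B) (hLam : 0 ≤ Lam) (hρ : 0 < ρ)
    (ht : 1 ≤ t) (hx : |x| ≤ ρ / 2) :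
    ‖partialT U (t, x)‖ ^ 2 + ‖partialX U (t, x)‖ ^ 2 / 2 + Lam * ‖U (t, x) - σ‖ ^ 2 ≤
      (65 + Lam) * bernsteinQuantity U σ B ρ t x := by
  have hη : 3 / 8 ≤ cutoff ρ t x := by
    have h1 : 1 / 2 ≤ t / (1 + t) := by
      rw [div_le_div_iff₀ (by norm_num) (by positivity)]; linarith
    have h2 : x ^ 2 / ρ ^ 2 ≤ 1 / 4 := by
      rw [div_le_iff₀ (by positivity)]
      have := pow_le_pow_left₀ (abs_nonneg x) hx 2
      rw [sq_abs] at this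
      linarith
    calc (3 / 8 : ℝ) = 1 / 2 * (3 / 4) := by norm_num
      _ ≤ _ := by unfold cutoff; gcongr; linarith
  have h2 : (1 / 160 : ℝ) ≤ cutoff ρ t x ^ 2 :=
    le_trans (by norm_num) (pow_le_pow_left₀ (by norm_num) hη 2)
  have h4 : (1 / 64 : ℝ) ≤ cutoff ρ t x ^ 4 :=
    le_trans (by norm_num) (pow_le_pow_left₀ (by norm_num) hη 4)
  have ha := mul_le_mul_of_nonneg_right h4 (sq_nonneg ‖partialT U (t, x)‖)
  have hb := mul_le_mul_of_nonneg_right h2 (sq_nonneg ‖partialX U (t, x)‖)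
  have hc := mul_le_mul_of_nonneg_right hB (sq_nonneg ‖U (t, x) - σ‖)
  have ha0 := sq_nonneg ‖partialT U (t, x)‖
  have hb0 := sq_nonneg ‖partialX U (t, x)‖
  have hc0 := sq_nonneg ‖U (t, x) - σ‖
  have hF : ‖U (t, x) - σ‖ ^ 2 ≤ bernsteinQuantity U σ B ρ t x := by
    unfold bernsteinQuantity; linarith
  have hF' : ‖partialT U (t, x)‖ ^ 2 + ‖partialX U (t, x)‖ ^ 2 / 2 ≤
      65 * bernsteinQuantity U σ B ρ t x := by
    unfold bernsteinQuantity; linarith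
  have := mul_le_mul_of_nonneg_left hF hLam
  linarith

/-- Theorem `pouf`: there is `K₁ > 0` depending only on `V` such that if
`[x₀ − 2R, x₀ + 2R]` avoids `D(0)` with `R ≥ α₀ε`, then pointwise on
`[x₀ − R/2, x₀ + R/2] × [ε², (R/K₀)² exp(R/(K₀ε))]`,
`ε³|∂ₜv_ε|² + e_ε(v_ε) ≤ K₁M₀ε⁻¹[exp(−t/(K₁ε²)) + (t/R²)exp(−R/(K₁ε))]`. -/
theorem pointwise_decay (P : MultiWell k) (μ₀ η₀ : ℝ)
    (hμ : GoodRadius P μ₀) (hη : 0 < η₀)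
    (hco : ∀ ε : ℝ, 0 < ε → ClearingOut P μ₀ η₀ ε) :
    ∃ K₁ > (0:ℝ), ∀ M₀ : ℝ, η₀ ≤ M₀ →
      ∀ ε : ℝ, 0 < ε →
      ∀ v : ℝ → ℝ → Euc k, IsSolution P ε v →
        Integrable (eDen P ε (v 0)) → energy P ε (v 0) ≤ M₀ →
      ∀ K₀ : ℝ, 0 < K₀ →
        (∀ R t : ℝ, 32 * M₀ / η₀ * ε ≤ R → 0 ≤ t →
          t ≤ (R / K₀) ^ 2 * Real.exp (R / (K₀ * ε)) →
          frontSet P μ₀ (v t) ⊆ frontSet P μ₀ (v 0) + Icc (-R) R) →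
      ∀ x₀ R : ℝ, 32 * M₀ / η₀ * ε ≤ R →
        Icc (x₀ - 2 * R) (x₀ + 2 * R) ∩ frontSet P μ₀ (v 0) = ∅ →
      ∀ x ∈ Icc (x₀ - R / 2) (x₀ + R / 2),
      ∀ t ∈ Icc (ε ^ 2) ((R / K₀) ^ 2 * Real.exp (R / (K₀ * ε))),
        ε ^ 3 * ‖deriv (fun s => v s x) t‖ ^ 2 + eDen P ε (v t) x
          ≤ K₁ * M₀ * ε⁻¹ * (Real.exp (-(t / (K₁ * ε ^ 2)))
              + t / R ^ 2 * Real.exp (-(R / (K₁ * ε)))) := by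
  obtain ⟨lam, hlam, hlamle⟩ := exists_lower_bound P
  obtain ⟨Lam, hLam, hLamle⟩ := exists_upper_bound P μ₀
  obtain ⟨κ, hκ, hκ2⟩ : ∃ κ : ℝ, 0 < κ ∧ κ ^ 2 = lam / 2 :=
    ⟨√(lam / 2), by positivity, Real.sq_sqrt (by positivity)⟩
  set B := 800 + 80 * Lam ^ 2 / κ ^ 2 with hB
  have hB1 : 1 ≤ B := by
    have : 0 ≤ 80 * Lam ^ 2 / κ ^ 2 := by positivity
    linarith
  have hμ0 := hμ.1
  set C := (65 + Lam) * (B * μ₀ ^ 2) * (1 + 64 / κ ^ 2) with hC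
  have hC0 : 0 < C := by positivity
  refine ⟨1 / κ ^ 2 + 4 / κ + C / η₀, by positivity, ?_⟩
  set K₁ := 1 / κ ^ 2 + 4 / κ + C / η₀ with hK₁
  have hK0 : 0 < K₁ := by positivity
  have hKa : 1 / K₁ ≤ κ ^ 2 := by
    rw [one_div_le hK0 (by positivity), hK₁, add_assoc]
    exact le_add_of_nonneg_right (by positivity)
  have hKb : 1 / K₁ ≤ κ / 4 := by
    rw [one_div_le hK0 (by positivity), one_div_div, hK₁]
    have h1 : 0 < 1 / κ ^ 2 := by positivity
    have h2 : 0 < C / η₀ := by positivity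
    linarith
  intro M₀ hM ε hε v hv _ _ K₀ _ hslow x₀ R hR hfree x hx t ht
  have hKc : C ≤ K₁ * M₀ := by
    calc C = C / η₀ * η₀ := by field_simp
      _ ≤ K₁ * M₀ := by
        gcongr
        rw [hK₁]
        exact le_add_of_nonneg_left (by positivity)
  have hRε : 32 * ε ≤ R := by
    refine le_trans ?_ hR
    gcongr
    rw [le_div_iff₀ hη]
    linarith
  have hR0 : 0 < R := by linarith
  set T := (R / K₀) ^ 2 * Real.exp (R / (K₀ * ε)) with hT
  have hclose : ∀ s ∈ Icc 0 T, ∀ y ∈ Icc (x₀ - R) (x₀ + R),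
      infDist (v s y) (P.wells : Set (Euc k)) < μ₀ := by
    intro s hs y hy
    by_contra! hfar
    obtain ⟨d, hd, r, hr, rfl⟩ := hslow R s hR hs.1 hs.2 hfar
    have : d ∈ Icc (x₀ - 2 * R) (x₀ + 2 * R) ∩ frontSet P μ₀ (v 0) :=
      ⟨⟨by linarith [hr.2, hy.1], by linarith [hr.1, hy.2]⟩, hd⟩
    rw [hfree] at this
    exact this
  set U : ℝ × ℝ → Euc k := fun p => Function.uncurry v (ε ^ 2 * p.1, x₀ + ε * p.2) with hUdef
  have hU : ContDiff ℝ (⊤ : ℕ∞) U := contDiff_rescale hv.1 _ _ _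
  have hscaled : ∀ p ∈ Icc 0 (T / ε ^ 2) ×ˢ Icc (-(R / ε)) (R / ε),
      infDist (U p) (P.wells : Set (Euc k)) < μ₀ := by
    rintro ⟨s, ξ⟩ ⟨hs, hξ⟩
    have hs2 := (le_div_iff₀ (by positivity)).1 hs.2
    have hξ1 := hξ.1
    rw [← neg_div, div_le_iff₀ hε] at hξ1
    have hξ2 := (le_div_iff₀ hε).1 hξ.2
    simp only at hs2 hξ1 hξ2
    exact hclose _ ⟨mul_nonneg (by positivity) hs.1, by linarith⟩ _
      ⟨by linarith, by linarith⟩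
  have hs1 : 1 ≤ t / ε ^ 2 := (one_le_div (by positivity)).2 ht.1
  have hsT : t / ε ^ 2 ≤ T / ε ^ 2 := by gcongr; exact ht.2
  have hρ2 : 2 ≤ R / ε := by rw [le_div_iff₀ hε]; linarith
  have hρ0 : 0 < R / ε := by positivity
  have hξ : |(x - x₀) / ε| ≤ R / ε / 2 := by
    rw [abs_div, abs_of_pos hε, div_right_comm]
    gcongr
    exact abs_le.2 ⟨by linarith [hx.1], by linarith [hx.2]⟩
  obtain ⟨hξ1, hξ2⟩ := abs_le.1 hξ
  have hξmem : (x - x₀) / ε ∈ Icc (-(R / ε)) (R / ε) := ⟨by linarith, by linarith⟩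
  have hsmem : t / ε ^ 2 ∈ Icc 0 (T / ε ^ 2) := ⟨by linarith, hsT⟩
  obtain ⟨σ, hσ, hball⟩ := exists_well_of_isPreconnected hμ
    (isPreconnected_Icc.prod isPreconnected_Icc) hU.continuous.continuousOn hscaled
    (p₀ := (t / ε ^ 2, (x - x₀) / ε)) ⟨hsmem, hξmem⟩
  have hest := bernsteinQuantity_le_barrier hU
    ((contDiff_gradient P.smooth).differentiable (by simp))
    (fun p hp => hv.rescale hε x₀ hp) hκ hρ2 (hsmem.1.trans hsmem.2) (gradient_well P hσ)
    (fun y hy w => by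
      rw [fderiv_gradient_inner P.smooth, hκ2]
      refine le_trans ?_ (hμ.2.2 σ hσ y hy w).1
      gcongr
      exact hlamle σ hσ)
    (fun y hy => (hLamle σ hσ y hy).1) (fun s hs y hy => hball (s, y) ⟨hs, hy⟩)
    _ hsmem _ hξmem
  have hctrl := sq_norms_le_bernsteinQuantity (U := U) (σ := σ) hB1 hLam.le hρ0 hs1 hξ
  have hbar := barrier_le hκ hρ0 hs1 hξ
  have hVle := (hLamle σ hσ _ (hball (t / ε ^ 2, (x - x₀) / ε) ⟨hsmem, hξmem⟩)).2
  have hpt : (ε ^ 2 * (t / ε ^ 2), x₀ + ε * ((x - x₀) / ε)) = (t, x) := by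
    ext <;> simp <;> field_simp
    ring
  have hUval : U (t / ε ^ 2, (x - x₀) / ε) = v t x := by
    simp only [hUdef, hpt]; rfl
  have hUt : partialT U (t / ε ^ 2, (x - x₀) / ε) = ε ^ 2 • deriv (fun s => v s x) t := by
    rw [hUdef, partialT_rescale hv.1, hpt, ← (hasDerivAt_partialT hv.1 t x).deriv]; rfl
  have hUx : partialX U (t / ε ^ 2, (x - x₀) / ε) = ε • deriv (v t) x := by
    rw [hUdef, partialX_rescale hv.1, hpt, ← (hasDerivAt_partialX hv.1 t x).deriv]; rfl
  rw [hUval] at hVle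
  rw [hUt, hUx, hUval, norm_smul, norm_smul, Real.norm_of_nonneg hε.le,
    Real.norm_of_nonneg (sq_nonneg ε)] at hctrl
  have hts : t / ε ^ 2 / (R / ε) ^ 2 = t / R ^ 2 := by field_simp
  rw [hts] at hbar
  have hexp1 : Real.exp (-(κ ^ 2 * (t / ε ^ 2))) ≤ Real.exp (-(t / (K₁ * ε ^ 2))) := by
    rw [Real.exp_le_exp, neg_le_neg_iff]
    calc t / (K₁ * ε ^ 2) = 1 / K₁ * (t / ε ^ 2) := by field_simp
      _ ≤ _ := by gcongr
  have hexp2 : Real.exp (-(κ / 4 * (R / ε))) ≤ Real.exp (-(R / (K₁ * ε))) := by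
    rw [Real.exp_le_exp, neg_le_neg_iff]
    calc R / (K₁ * ε) = 1 / K₁ * (R / ε) := by field_simp
      _ ≤ _ := by gcongr
  have ht0 : 0 ≤ t := (sq_nonneg ε).trans ht.1
  have hbar' : barrier κ (R / ε) (t / ε ^ 2) ((x - x₀) / ε) ≤ (1 + 64 / κ ^ 2) *
      (Real.exp (-(t / (K₁ * ε ^ 2))) + t / R ^ 2 * Real.exp (-(R / (K₁ * ε)))) := by
    have h1 : Real.exp (-(κ ^ 2 * (t / ε ^ 2))) ≤
        (1 + 64 / κ ^ 2) * Real.exp (-(t / (K₁ * ε ^ 2))) :=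
      hexp1.trans (le_mul_of_one_le_left (Real.exp_pos _).le
        (le_add_of_nonneg_right (by positivity)))
    have h2 : 64 / κ ^ 2 * (t / R ^ 2 * Real.exp (-(κ / 4 * (R / ε)))) ≤
        (1 + 64 / κ ^ 2) * (t / R ^ 2 * Real.exp (-(R / (K₁ * ε)))) := by
      gcongr
      exact le_add_of_nonneg_left zero_le_one
    linear_combination hbar + h1 + h2
  calc ε ^ 3 * ‖deriv (fun s => v s x) t‖ ^ 2 + eDen P ε (v t) x
      = ε⁻¹ * ((ε ^ 2 * ‖deriv (fun s => v s x) t‖) ^ 2 + (ε * ‖deriv (v t) x‖) ^ 2 / 2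
          + P.V (v t x)) := by
        unfold eDen; field_simp; ring
    _ ≤ ε⁻¹ * ((65 + Lam) * (B * μ₀ ^ 2 * ((1 + 64 / κ ^ 2) *
          (Real.exp (-(t / (K₁ * ε ^ 2))) + t / R ^ 2 * Real.exp (-(R / (K₁ * ε))))))) := by
        gcongr
        refine (add_le_add_right hVle _).trans (hctrl.trans ?_)
        gcongr
        exact hest.trans (by gcongr)
    _ = C * ε⁻¹ * (Real.exp (-(t / (K₁ * ε ^ 2)))
          + t / R ^ 2 * Real.exp (-(R / (K₁ * ε)))) := by rw [hC]; ring
    _ ≤ _ := by gcongr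
end
end
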